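/- arXiv:2111.03034 — 4 statements merged into one kernel-verified Lean document; each statement's English description precedes it below -/
import Mathlib

section
/- Let μ be a distribution over {-1,+1}^V with n = |V|, let η > 0 and θ ∈ (0,1). For every integer k > (η+2)/(θn), if the k-transformed distribution μ_k = Trans(μ, k) is η-spectrally independent in ∞-norm with all fields, then μ_k satisfies ⌈θkn⌉-uniform block factorization of entropy with parameter C = (e/θ)^{η+2}. -/
open Classical Finset

noncomputable section

namespace PaperIsing

/-- A configuration assigns to each vertex a spin; `true` encodes `+1`, `false` encodes `-1`. -/
abbrev Conf (V : Type*) := V → Bool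

variable {V : Type*} [Fintype V] [DecidableEq V]

/-- `μ` is a probability distribution on the finite type `A`. -/
def IsDist {A : Type*} [Fintype A] (μ : A → ℝ) : Prop :=
  (∀ a, 0 ≤ μ a) ∧ ∑ a, μ a = 1

/-- Entropy functional `Ent_μ[f] = E_μ[f log f] − E_μ[f] log E_μ[f]`
(the convention `0 log 0 = 0` holds since `Real.log 0 = 0`). -/
def entOf {A : Type*} [Fintype A] (μ f : A → ℝ) : ℝ :=
  (∑ a, μ a * (f a * Real.log (f a))) - (∑ a, μ a * f a) * Real.log (∑ a, μ a * f a)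

/-- KL divergence `KL(ν‖μ)`. -/
def klDivF {A : Type*} [Fintype A] (ν μ : A → ℝ) : ℝ :=
  ∑ a, ν a * Real.log (ν a / μ a)

/-- The covariance of `f` and `log f` with respect to `ν`. -/
def ment {A : Type*} [Fintype A] (ν f : A → ℝ) : ℝ :=
  (1/2) * ∑ σ : A, ∑ τ : A, ν σ * ν τ * (f σ - f τ) * (Real.log (f σ) - Real.log (f τ))

/-- Total variation distance between two distributions on a finite type. -/
def tvDist {A : Type*} [Fintype A] (p q : A → ℝ) : ℝ :=
  (1/2) * ∑ a, |p a - q a|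

/-- The set of `+1` vertices of a configuration. -/
def plusSet (σ : Conf V) : Finset V := Finset.univ.filter (fun v => σ v = true)

/-- `‖σ‖₊`, the number of `+1` spins. -/
def plusCount (σ : Conf V) : ℕ := (plusSet σ).card

/-- Marginal probability, under `μ`, that the configuration agrees with `τ` on `Λ`. -/
def margin (μ : Conf V → ℝ) (Λ : Finset V) (τ : Conf V) : ℝ :=
  ∑ σ : Conf V, if ∀ v ∈ Λ, σ v = τ v then μ σ else 0

/-- `μ` conditioned on agreeing with `τ` on `Λ`. -/
def condDist (μ : Conf V → ℝ) (Λ : Finset V) (τ : Conf V) : Conf V → ℝ :=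
  fun σ => if ∀ v ∈ Λ, σ v = τ v then μ σ / margin μ Λ τ else 0

/-- Transition matrix of the Glauber dynamics for `μ`:
pick `v` uniformly, resample the spin at `v` from the conditional marginal. -/
def glauber (μ : Conf V → ℝ) (σ τ : Conf V) : ℝ :=
  (Fintype.card V : ℝ)⁻¹ * ∑ v : V, condDist μ (Finset.univ.erase v) σ τ

/-- Dirichlet form `E_P(f, log f) = ⟨f, (I−P) log f⟩_μ` for the Glauber dynamics `P` on `μ`. -/
def dirichletLog (μ f : Conf V → ℝ) : ℝ :=
  ∑ σ : Conf V, μ σ * f σ * (Real.log (f σ) - ∑ τ : Conf V, glauber μ σ τ * Real.log (f τ))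

/-- Modified log-Sobolev constant of the Glauber dynamics on `μ`. -/
def mlsConst (μ : Conf V → ℝ) : ℝ :=
  sInf {r : ℝ | ∃ f : Conf V → ℝ, (∀ σ, 0 ≤ f σ) ∧ entOf μ f ≠ 0 ∧
    r = dirichletLog μ f / entOf μ f}

/-- Modified log-Sobolev constant under the worst pinning. -/
def mlsMin (μ : Conf V → ℝ) : ℝ :=
  sInf {r : ℝ | ∃ (Λ : Finset V) (τ : Conf V), 0 < margin μ Λ τ ∧
    r = mlsConst (condDist μ Λ τ)}

/-- Imposing local fields `lam` on `μ`: `μ^(λ)(σ) ∝ μ(σ) ∏_{v : σ_v = +1} λ_v`. -/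
def magnetize (μ : Conf V → ℝ) (lam : V → ℝ) : Conf V → ℝ :=
  fun σ => (μ σ * ∏ v : V, if σ v then lam v else 1) /
    (∑ τ : Conf V, μ τ * ∏ v : V, if τ v then lam v else 1)

/-- Imposing the constant local field `θ`. -/
def magnetizeC (μ : Conf V → ℝ) (θ : ℝ) : Conf V → ℝ :=
  magnetize μ (fun _ => θ)

/-- `Z_π = ∑_σ μ(σ) θ^{‖σ‖₊}`. -/
def Zmag (μ : Conf V → ℝ) (θ : ℝ) : ℝ :=
  ∑ σ : Conf V, μ σ * θ ^ plusCount σ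

/-- `Pr_μ[σ_v = +1 ∣ σ_u = b]`. -/
def condPlusProb (μ : Conf V → ℝ) (u : V) (b : Bool) (v : V) : ℝ :=
  (∑ σ : Conf V, if σ u = b ∧ σ v = true then μ σ else 0) /
  (∑ σ : Conf V, if σ u = b then μ σ else 0)

/-- Signed influence matrix `Ψ^inf_μ(u,v)`. -/
def infl (μ : Conf V → ℝ) (u v : V) : ℝ :=
  if u ≠ v ∧ 0 < (∑ σ : Conf V, if σ u = true then μ σ else 0) ∧
      0 < (∑ σ : Conf V, if σ u = false then μ σ else 0)
  then condPlusProb μ u true v - condPlusProb μ u false v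
  else 0

/-- `μ` is `η`-spectrally independent in `∞`-norm. -/
def SIinf (μ : Conf V → ℝ) (η : ℝ) : Prop :=
  ∀ u : V, ∑ v : V, |infl μ u v| ≤ η

/-- `μ` is `η`-spectrally independent in `∞`-norm with all fields. -/
def SIinfAllFields (μ : Conf V → ℝ) (η : ℝ) : Prop :=
  ∀ lam : V → ℝ, (∀ v, 0 < lam v) → SIinf (magnetize μ lam) η

/-- The projection `σ ↦ σ*` from configurations on `V × [k]` to configurations on `V`. -/
def kstar {k : ℕ} (τ : Conf (V × Fin k)) : Conf V :=
  fun v => decide (∃ i : Fin k, τ (v, i) = true)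

/-- The `k`-transformation `μ_k = Trans(μ, k)` of `μ`. -/
def ktrans (μ : Conf V → ℝ) (k : ℕ) : Conf (V × Fin k) → ℝ :=
  fun τ =>
    if ∀ v : V, (Finset.univ.filter (fun i : Fin k => τ (v, i) = true)).card ≤ 1
    then μ (kstar τ) * ((k : ℝ)⁻¹) ^ plusCount (kstar τ)
    else 0

/-- Probability of the subset `R` under `Bin(V, 1−θ)`. -/
def binWeight (θ : ℝ) (R : Finset V) : ℝ :=
  (1 - θ) ^ R.card * θ ^ (Fintype.card V - R.card)

/-- The term `π_R(𝟙_R) ⬝ Ent_{π^{𝟙_R}}[f]` with `π = μ^(θ)`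
(when `π_R(𝟙_R) = 0` this product is `0`, matching the convention). -/
def mbfTerm (μ : Conf V → ℝ) (θ : ℝ) (f : Conf V → ℝ) (R : Finset V) : ℝ :=
  margin (magnetizeC μ θ) R (fun _ => true) *
    entOf (condDist (magnetizeC μ θ) R (fun _ => true)) f

/-- `θ`-magnetized block factorization of entropy with parameter `C`. -/
def MBF (μ : Conf V → ℝ) (θ C : ℝ) : Prop :=
  ∀ f : Conf V → ℝ, (∀ σ, 0 ≤ f σ) →
    entOf μ f ≤ C * (Zmag μ θ / θ ^ (Fintype.card V)) *
      ∑ R : Finset V, binWeight θ R * mbfTerm μ θ f R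

/-- `ν[Ent_S[f]] = ∑_{σ ∈ Ω(ν_{W∖S})} ν_{W∖S}(σ) Ent_{ν^σ}[f]`, with canonical
representatives `χ` vanishing on `S`. -/
def avgEnt {W : Type*} [Fintype W] [DecidableEq W]
    (ν : Conf W → ℝ) (S : Finset W) (f : Conf W → ℝ) : ℝ :=
  ∑ χ : Conf W, if ∀ v ∈ S, χ v = false
    then margin ν (Finset.univ \ S) χ * entOf (condDist ν (Finset.univ \ S) χ) f
    else 0

/-- `ℓ`-uniform block factorization of entropy with parameter `C`. -/
def UBF {W : Type*} [Fintype W] [DecidableEq W]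
    (ν : Conf W → ℝ) (ℓ : ℕ) (C : ℝ) : Prop :=
  ∀ f : Conf W → ℝ, (∀ σ, 0 ≤ f σ) →
    entOf ν f ≤ (C / (Nat.choose (Fintype.card W) ℓ : ℝ)) *
      ∑ S ∈ Finset.powersetCard ℓ (Finset.univ : Finset W), avgEnt ν S f

/-- The down walk applied to a distribution: `(ν D_{k→j})(β) = Σ_{α ⊇ β} ν(α)/C(k,j)`
for `|β| = j`. -/
def downDist {U : Type*} [Fintype U] [DecidableEq U]
    (ν : Finset U → ℝ) (k j : ℕ) : Finset U → ℝ :=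
  fun β => if β.card = j
    then (∑ α : Finset U, if β ⊆ α ∧ α.card = k then ν α else 0) / (Nat.choose k j : ℝ)
    else 0

/-- The up walk applied to a function:
`(U_{j→k} f)(α) = (Σ_{β ⊇ α} μ(β) f(β)) / (Σ_{γ ⊇ α} μ(γ))` for `μ` supported on size-`k` sets. -/
def upFun {U : Type*} [Fintype U] [DecidableEq U]
    (μ f : Finset U → ℝ) : Finset U → ℝ :=
  fun α => (∑ β : Finset U, if α ⊆ β then μ β * f β else 0) /
    (∑ γ : Finset U, if α ⊆ γ then μ γ else 0)

/-- The multivariate hypergeometric distribution `HG(V, k, ℓ)`. -/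
def hyperGeo (V : Type*) [Fintype V] (k ℓ : ℕ) (a : V → ℕ) : ℝ :=
  if ∑ v, a v = ℓ
  then (∏ v, (Nat.choose k (a v) : ℝ)) / (Nat.choose (k * Fintype.card V) ℓ : ℝ)
  else 0

/-- The flipped distribution `flip(μ, χ)(σ) = μ(σ ⊙ χ)`, where `(σ ⊙ χ)_v = σ_v χ_v`. -/
def flipDist (μ : Conf V → ℝ) (χ : Conf V) : Conf V → ℝ :=
  fun σ => μ (fun v => σ v == χ v)

/-- The number of monochromatic edges of `G` under `σ`. -/
def monoCount (G : SimpleGraph V) (σ : Conf V) : ℕ :=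
  (Finset.univ.filter (fun e : Sym2 V =>
    e ∈ G.edgeSet ∧ ∀ a ∈ e, ∀ b ∈ e, σ a = σ b)).card

/-- The Gibbs distribution of the Ising model `(G, β, λ)`. -/
def isingGibbs (G : SimpleGraph V) (β : ℝ) (lam : V → ℝ) : Conf V → ℝ :=
  fun σ => (β ^ monoCount G σ * ∏ v : V, if σ v then lam v else 1) /
    (∑ τ : Conf V, β ^ monoCount G τ * ∏ v : V, if τ v then lam v else 1)

/-- Distribution of the Glauber dynamics on `μ` after `t` steps, started from initial
distribution `ν`. -/
def chainDist (μ ν : Conf V → ℝ) : ℕ → Conf V → ℝ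
  | 0 => ν
  | (t+1) => fun τ => ∑ σ : Conf V, chainDist μ ν t σ * glauber μ σ τ

/-- `‖Ψ^inf_μ‖_∞ = max_u Σ_v |Ψ^inf_μ(u,v)|`. -/
def psiNorm [Nonempty V] (μ : Conf V → ℝ) : ℝ :=
  Finset.univ.sup' Finset.univ_nonempty (fun u => ∑ v : V, |infl μ u v|)

end PaperIsing

open PaperIsing

namespace KT

variable {W : Type*} [Fintype W] [DecidableEq W]

/-- quadratic (spectral) inequality for all tilts -/
def PQ (m : Conf W → ℝ) (K : ℝ) : Prop :=
  ∀ w : W → Bool → ℝ, (∀ v b, 0 ≤ w v b) → ∀ a : W → Bool → ℝ,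
    (∑ σ, m σ * ∏ v, w v (σ v)) * (∑ σ, (m σ * ∏ v, w v (σ v)) * (∑ v, a v (σ v)) ^ 2)
      - (∑ σ, (m σ * ∏ v, w v (σ v)) * (∑ v, a v (σ v))) ^ 2
    ≤ K * ((∑ σ, m σ * ∏ v, w v (σ v)) *
        ∑ σ, (m σ * ∏ v, w v (σ v)) * (∑ v, (a v (σ v)) ^ 2))

lemma PQ_mul {m : Conf W → ℝ} {K : ℝ} (h : PQ m K) (w : W → Bool → ℝ)
    (hw : ∀ v b, 0 ≤ w v b) : PQ (fun σ => m σ * ∏ v, w v (σ v)) K := by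
  intro w' hw' a
  have := h (fun v b => w v b * w' v b) (fun v b => mul_nonneg (hw v b) (hw' v b)) a
  simpa only [Finset.prod_mul_distrib, ← mul_assoc] using this

lemma PQ_of_pos {m : Conf W → ℝ} {K : ℝ}
    (h : ∀ w : W → Bool → ℝ, (∀ v b, 0 < w v b) → ∀ a : W → Bool → ℝ,
    (∑ σ, m σ * ∏ v, w v (σ v)) * (∑ σ, (m σ * ∏ v, w v (σ v)) * (∑ v, a v (σ v)) ^ 2)
      - (∑ σ, (m σ * ∏ v, w v (σ v)) * (∑ v, a v (σ v))) ^ 2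
    ≤ K * ((∑ σ, m σ * ∏ v, w v (σ v)) *
        ∑ σ, (m σ * ∏ v, w v (σ v)) * (∑ v, (a v (σ v)) ^ 2))) : PQ m K := by
  intro w hw a
  have key : ∀ ε : ℝ, 0 < ε → _ := fun ε hε => h (fun v b => w v b + ε)
    (fun v b => add_pos_of_nonneg_of_pos (hw v b) hε) a
  have hc1 : Continuous (fun ε : ℝ =>
      (∑ σ, m σ * ∏ v, (w v (σ v) + ε)) * (∑ σ, (m σ * ∏ v, (w v (σ v) + ε)) * (∑ v, a v (σ v)) ^ 2)
      - (∑ σ, (m σ * ∏ v, (w v (σ v) + ε)) * (∑ v, a v (σ v))) ^ 2) := by fun_prop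
  have hc2 : Continuous (fun ε : ℝ =>
      K * ((∑ σ, m σ * ∏ v, (w v (σ v) + ε)) *
        ∑ σ, (m σ * ∏ v, (w v (σ v) + ε)) * (∑ v, (a v (σ v)) ^ 2))) := by fun_prop
  have t1 := (hc1.tendsto 0).mono_left (nhdsWithin_le_nhds (s := Set.Ioi 0))
  have t2 := (hc2.tendsto 0).mono_left (nhdsWithin_le_nhds (s := Set.Ioi 0))
  have := le_of_tendsto_of_tendsto t1 t2 (by
    filter_upwards [self_mem_nhdsWithin] with ε hε
    exact key ε hε)
  simpa only [add_zero] using this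

/-- variance bound for a probability distribution -/
lemma var_bound (π : Conf W → ℝ) (hπ : ∀ σ, 0 ≤ π σ) (hs : ∑ σ, π σ = 1) (η : ℝ)
    (hSI : SIinf π η) (a : W → Bool → ℝ) :
    (∑ σ, π σ * (∑ v, a v (σ v)) ^ 2) - (∑ σ, π σ * (∑ v, a v (σ v))) ^ 2
      ≤ (η + 1) * ∑ σ, π σ * (∑ v, (a v (σ v)) ^ 2) := by
  set X : W → Conf W → ℝ := fun v σ => if σ v = true then 1 else 0 with hX
  set p : W → ℝ := fun v => ∑ σ, π σ * X v σ with hp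
  set cov : W → W → ℝ := fun u v => (∑ σ, π σ * (X u σ * X v σ)) - p u * p v with hcov
  set c : W → ℝ := fun v => a v true - a v false with hc
  have ha : ∀ v σ, a v (σ v) = c v * X v σ + a v false := by
    intro v σ
    by_cases h : σ v = true
    · simp [hX, hc, h]
    · simp [hX, hc, h]
  have hXX : ∀ v σ, X v σ * X v σ = X v σ := by
    intro v σ; simp only [hX]; split_ifs <;> simp
  have hcuu : ∀ u, cov u u = p u * (1 - p u) := by
    intro u; simp only [hcov, hXX]; simp only [hp]; ring
  have hX0 : ∀ v σ, 0 ≤ X v σ := by intro v σ; simp only [hX]; split_ifs <;> simp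
  have hX1 : ∀ v σ, X v σ ≤ 1 := by intro v σ; simp only [hX]; split_ifs <;> simp
  have hp0 : ∀ v, 0 ≤ p v := fun v => Finset.sum_nonneg fun σ _ => mul_nonneg (hπ σ) (hX0 v σ)
  have hp1 : ∀ v, p v ≤ 1 := fun v => by
    rw [← hs]; exact Finset.sum_le_sum fun σ _ => mul_le_of_le_one_right (hπ σ) (hX1 v σ)
  have hV : ∀ v, 0 ≤ cov v v := fun v => by
    rw [hcuu]; exact mul_nonneg (hp0 v) (by linarith [hp1 v])
  have hsymm : ∀ u v, cov u v = cov v u := by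
    intro u v; simp only [hcov]
    rw [mul_comm (p u)]; simp only [mul_comm (X u _)]
  -- influence
  have e1 : ∀ u, (∑ σ : Conf W, if σ u = true then π σ else 0) = p u := by
    intro u; refine Finset.sum_congr rfl fun σ _ => ?_
    simp only [hX]; split_ifs <;> simp
  have e0 : ∀ u, (∑ σ : Conf W, if σ u = false then π σ else 0) = 1 - p u := by
    intro u; rw [← hs]; simp only [hp]; rw [← Finset.sum_sub_distrib]
    refine Finset.sum_congr rfl fun σ _ => ?_
    simp only [hX]; cases σ u <;> simp
  have e11 : ∀ u v, (∑ σ : Conf W, if σ u = true ∧ σ v = true then π σ else 0)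
      = cov u v + p u * p v := by
    intro u v; simp only [hcov, sub_add_cancel]; refine Finset.sum_congr rfl fun σ _ => ?_
    simp only [hX]; cases σ u <;> cases σ v <;> simp
  have e01 : ∀ u v, (∑ σ : Conf W, if σ u = false ∧ σ v = true then π σ else 0)
      = p v - (cov u v + p u * p v) := by
    intro u v; simp only [hcov, sub_add_cancel]
    conv_rhs => rw [hp]
    rw [← Finset.sum_sub_distrib]; refine Finset.sum_congr rfl fun σ _ => ?_
    simp only [hX]; cases σ u <;> cases σ v <;> simp
  have hz : ∀ u v, p u = 0 → cov u v = 0 := by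
    intro u v h
    have h' := (Finset.sum_eq_zero_iff_of_nonneg
      (fun σ _ => mul_nonneg (hπ σ) (hX0 u σ))).1 h
    simp only [hcov, h, zero_mul, sub_zero]
    refine Finset.sum_eq_zero fun σ hσ => ?_
    rw [← mul_assoc, h' σ hσ, zero_mul]
  have hone : ∀ u v, 1 - p u = 0 → cov u v = 0 := by
    intro u v h
    have h2 := h
    rw [← e0 u] at h2
    have h' := (Finset.sum_eq_zero_iff_of_nonneg
      (fun σ _ => by split_ifs; exacts [hπ σ, le_rfl])).1 h2
    have h3 := e01 u v
    rw [Finset.sum_eq_zero] at h3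
    · have : p u = 1 := by linarith
      rw [this] at h3; linarith
    · intro σ hσ
      have := h' σ hσ
      split_ifs with hh
      · simpa [hh.1] using this
      · rfl
  have hinf : ∀ u v, u ≠ v → cov u v = cov u u * infl π u v := by
    intro u v huv
    unfold infl
    rw [e1, e0]
    by_cases h1 : 0 < p u
    · by_cases h2 : 0 < 1 - p u
      · rw [if_pos ⟨huv, h1, h2⟩]
        unfold condPlusProb
        rw [e1, e0, e11, e01, hcuu]
        field_simp
        ring
      · rw [if_neg (by tauto), mul_zero]
        exact hone u v (le_antisymm (not_lt.1 h2) (by linarith [hp1 u]))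
    · rw [if_neg (by tauto), mul_zero]
      exact hz u v (le_antisymm (not_lt.1 h1) (hp0 u))
  have hrow : ∀ u, ∑ v, |cov u v| ≤ (η + 1) * cov u u := by
    intro u
    have : ∀ v, |cov u v| = cov u u * |infl π u v| + (if u = v then cov u u else 0) := by
      intro v
      by_cases h : u = v
      · subst h; simp [infl, abs_of_nonneg (hV u)]
      · rw [hinf u v h, abs_mul, abs_of_nonneg (hV u), if_neg h, add_zero]
    simp only [this, Finset.sum_add_distrib, ← Finset.mul_sum, Finset.sum_ite_eq,
      Finset.mem_univ, if_true]
    nlinarith [mul_le_mul_of_nonneg_left (hSI u) (hV u)]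
  -- variance as quadratic form
  set E : ℝ := ∑ v, a v false with hE
  have hA : ∀ σ, ∑ v, a v (σ v) = (∑ v, c v * X v σ) + E := by
    intro σ; rw [hE, ← Finset.sum_add_distrib]; exact Finset.sum_congr rfl fun v _ => ha v σ
  clear_value E
  have m1 : ∑ σ, π σ * (∑ v, c v * X v σ) = ∑ v, c v * p v := by
    simp only [hp, Finset.mul_sum]; rw [Finset.sum_comm]
    refine Finset.sum_congr rfl fun v _ => Finset.sum_congr rfl fun σ _ => by ring
  have m2 : ∑ σ, π σ * (∑ v, c v * X v σ) ^ 2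
      = ∑ u, ∑ v, c u * c v * (cov u v + p u * p v) := by
    simp only [sq, Finset.sum_mul_sum]
    simp only [hcov, sub_add_cancel, Finset.mul_sum]
    rw [Finset.sum_comm]
    refine Finset.sum_congr rfl fun u _ => ?_
    rw [Finset.sum_comm]
    refine Finset.sum_congr rfl fun v _ => Finset.sum_congr rfl fun σ _ => by ring
  have m3 : (∑ v, c v * p v) ^ 2 = ∑ u, ∑ v, c u * c v * (p u * p v) := by
    rw [sq, Finset.sum_mul_sum]
    refine Finset.sum_congr rfl fun u _ => Finset.sum_congr rfl fun v _ => by ring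
  have hvar : (∑ σ, π σ * (∑ v, a v (σ v)) ^ 2) - (∑ σ, π σ * (∑ v, a v (σ v))) ^ 2
      = ∑ u, ∑ v, c u * c v * cov u v := by
    have q1 : ∑ σ, π σ * (∑ v, a v (σ v)) ^ 2 =
        (∑ σ, π σ * (∑ v, c v * X v σ) ^ 2) + 2 * E * (∑ σ, π σ * (∑ v, c v * X v σ)) + E ^ 2 := by
      rw [← mul_one (E ^ 2), ← hs, Finset.mul_sum, Finset.mul_sum, ← Finset.sum_add_distrib,
        ← Finset.sum_add_distrib]
      refine Finset.sum_congr rfl fun σ _ => ?_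
      rw [hA]; ring
    have q2 : ∑ σ, π σ * (∑ v, a v (σ v)) = (∑ σ, π σ * (∑ v, c v * X v σ)) + E := by
      rw [← mul_one E, ← hs, Finset.mul_sum, ← Finset.sum_add_distrib]
      refine Finset.sum_congr rfl fun σ _ => ?_
      rw [hA]; ring
    rw [q1, q2, m1, m2]
    have : ∑ u, ∑ v, c u * c v * (cov u v + p u * p v)
        = (∑ u, ∑ v, c u * c v * cov u v) + (∑ v, c v * p v) ^ 2 := by
      rw [m3, ← Finset.sum_add_distrib]
      refine Finset.sum_congr rfl fun u _ => ?_
      rw [← Finset.sum_add_distrib]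
      refine Finset.sum_congr rfl fun v _ => by ring
    rw [this]; ring
  have hquad : ∑ u, ∑ v, c u * c v * cov u v ≤ ∑ u, c u ^ 2 * ∑ v, |cov u v| := by
    have s1 : ∀ u v, c u * c v * cov u v ≤ (c u ^ 2 / 2) * |cov u v| + (c v ^ 2 / 2) * |cov v u| := by
      intro u v
      rw [hsymm v u, ← add_mul]
      calc c u * c v * cov u v ≤ |c u * c v * cov u v| := le_abs_self _
        _ = |c u| * |c v| * |cov u v| := by rw [abs_mul, abs_mul]
        _ ≤ _ := by
          apply mul_le_mul_of_nonneg_right _ (abs_nonneg _)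
          nlinarith [sq_nonneg (|c u| - |c v|), sq_abs (c u), sq_abs (c v)]
    calc _ ≤ ∑ u, ∑ v, ((c u ^ 2 / 2) * |cov u v| + (c v ^ 2 / 2) * |cov v u|) :=
          Finset.sum_le_sum fun u _ => Finset.sum_le_sum fun v _ => s1 u v
      _ = (∑ u, ∑ v, (c u ^ 2 / 2) * |cov u v|) + ∑ u, ∑ v, (c v ^ 2 / 2) * |cov v u| := by
          simp only [Finset.sum_add_distrib]
      _ = (∑ u, ∑ v, (c u ^ 2 / 2) * |cov u v|) + ∑ u, ∑ v, (c u ^ 2 / 2) * |cov u v| := by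
          congr 1; rw [Finset.sum_comm]
      _ = _ := by
          rw [← Finset.sum_add_distrib]
          refine Finset.sum_congr rfl fun u _ => ?_
          rw [← Finset.mul_sum]; ring
  have hη : ∀ u : W, 0 ≤ η := fun u => le_trans (Finset.sum_nonneg fun v _ => abs_nonneg _) (hSI u)
  have hdiag : ∀ v, c v ^ 2 * cov v v ≤ ∑ σ, π σ * (a v (σ v)) ^ 2 := by
    intro v
    have : ∑ σ, π σ * (a v (σ v)) ^ 2 = (c v ^ 2 + 2 * c v * a v false) * p v + a v false ^ 2 := by
      rw [← mul_one (a v false ^ 2), ← hs]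
      simp only [hp, Finset.mul_sum]
      rw [← Finset.sum_add_distrib]
      refine Finset.sum_congr rfl fun σ _ => ?_
      rw [ha, add_sq, mul_pow, sq (X v σ), hXX]; ring
    rw [this, hcuu]
    nlinarith [sq_nonneg (c v * p v + a v false)]
  rw [hvar]
  have hsw : ∑ σ, π σ * (∑ v, (a v (σ v)) ^ 2) = ∑ v, ∑ σ, π σ * (a v (σ v)) ^ 2 := by
    simp only [Finset.mul_sum]; rw [Finset.sum_comm]
  rw [hsw, Finset.mul_sum]
  refine hquad.trans (Finset.sum_le_sum fun u _ => ?_)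
  calc c u ^ 2 * ∑ v, |cov u v| ≤ c u ^ 2 * ((η + 1) * cov u u) :=
        mul_le_mul_of_nonneg_left (hrow u) (sq_nonneg _)
    _ = (η + 1) * (c u ^ 2 * cov u u) := by ring
    _ ≤ _ := mul_le_mul_of_nonneg_left (hdiag u) (by linarith [hη u])

lemma PQ_of_SI (ν : Conf W → ℝ) (hν : IsDist ν) (η : ℝ) (h : SIinfAllFields ν η) :
    PQ ν (η + 1) := by
  apply PQ_of_pos
  intro w hw a
  set D : ℝ := ∏ v, w v false with hD
  have hDpos : 0 < D := Finset.prod_pos fun v _ => hw v false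
  set lam : W → ℝ := fun v => w v true / w v false with hlam
  have hl : ∀ v, 0 < lam v := fun v => div_pos (hw v true) (hw v false)
  have hprod : ∀ σ : Conf W, ∏ v, w v (σ v) = D * ∏ v, (if σ v then lam v else 1) := by
    intro σ
    rw [hD, ← Finset.prod_mul_distrib]
    refine Finset.prod_congr rfl fun v _ => ?_
    cases σ v
    · simp
    · have := (hw v false).ne'
      simp [hlam]; field_simp
  have hpp : ∀ σ : Conf W, 0 < ∏ v, w v (σ v) := fun σ => Finset.prod_pos fun v _ => hw v _
  set m : Conf W → ℝ := fun σ => ν σ * ∏ v, w v (σ v) with hm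
  have hm0 : ∀ σ, 0 ≤ m σ := fun σ => mul_nonneg (hν.1 σ) (hpp σ).le
  set Z : ℝ := ∑ σ, m σ with hZ
  have hZpos : 0 < Z := by
    obtain ⟨σ, hσ⟩ : ∃ σ, ν σ ≠ 0 := by
      by_contra hcon; push Not at hcon
      have := hν.2; simp [hcon] at this
    exact Finset.sum_pos' (fun σ _ => hm0 σ)
      ⟨σ, Finset.mem_univ _, mul_pos (lt_of_le_of_ne (hν.1 σ) hσ.symm) (hpp σ)⟩
  have hmag : ∀ σ, magnetize ν lam σ = m σ / Z := by
    intro σ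
    simp only [magnetize, hZ, hm, hprod]
    have : ∑ τ : Conf W, ν τ * (D * ∏ v, (if τ v then lam v else 1))
      = D * ∑ τ : Conf W, ν τ * ∏ v, (if τ v then lam v else 1) := by
      rw [Finset.mul_sum]; exact Finset.sum_congr rfl fun τ _ => by ring
    rw [this, mul_left_comm, mul_div_mul_left _ _ hDpos.ne']
  have := var_bound (magnetize ν lam) (fun σ => by rw [hmag]; exact div_nonneg (hm0 σ) hZpos.le)
    (by simp only [hmag]; rw [← Finset.sum_div, div_self hZpos.ne']) η (h lam hl) a
  simp only [hmag, div_mul_eq_mul_div] at this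
  simp only [← Finset.sum_div] at this
  change Z * (∑ σ, m σ * (∑ v, a v (σ v)) ^ 2) - (∑ σ, m σ * (∑ v, a v (σ v))) ^ 2
    ≤ (η + 1) * (Z * ∑ σ, m σ * (∑ v, (a v (σ v)) ^ 2))
  rw [div_pow, ← mul_div_assoc, div_sub_div _ _ hZpos.ne' (by positivity),
    div_le_div_iff₀ (by positivity) hZpos] at this
  have h2 : 0 < Z * Z := by positivity
  have h3 : (Z * (∑ σ, m σ * (∑ v, a v (σ v)) ^ 2) - (∑ σ, m σ * (∑ v, a v (σ v))) ^ 2) * (Z * Z)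
    ≤ ((η + 1) * (Z * ∑ σ, m σ * (∑ v, (a v (σ v)) ^ 2))) * (Z * Z) := by
    refine le_of_eq_of_le ?_ (this.trans (le_of_eq ?_)) <;> ring
  exact le_of_mul_le_mul_right h3 h2

lemma anti_of_hasDeriv {F F' : ℝ → ℝ} (h : ∀ s ∈ Set.Icc (0:ℝ) 1, HasDerivAt F (F' s) s)
    (hn : ∀ s ∈ Set.Icc (0:ℝ) 1, F' s ≤ 0) : AntitoneOn F (Set.Icc 0 1) := by
  apply antitoneOn_of_deriv_nonpos (convex_Icc 0 1)
  · exact fun s hs => (h s hs).continuousAt.continuousWithinAt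
  · exact fun s hs => (h s (interior_subset hs)).differentiableAt.differentiableWithinAt
  · intro s hs
    rw [(h s (interior_subset hs)).deriv]; exact hn s (interior_subset hs)

lemma tilt_le (m : Conf W → ℝ) (hm : ∀ σ, 0 ≤ m σ) (hZ : 0 < ∑ σ, m σ) (K : ℝ) (hK : 0 < K)
    (hP : PQ m K) (w : W → Bool → ℝ) (hw : ∀ v b, 0 < w v b)
    (hb : ∀ v, ∑ σ, m σ * (w v (σ v) - 1) = 0) :
    ∑ σ, m σ * Real.exp (K⁻¹ * ∑ v, Real.log (w v (σ v))) ≤ ∑ σ, m σ := by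
  set B : W → Bool → ℝ → ℝ := fun v b s => 1 + s * (w v b - 1) with hB
  have hBpos : ∀ s ∈ Set.Icc (0:ℝ) 1, ∀ v b, 0 < B v b s := by
    intro s hs v b
    have h1 := hw v b
    have : B v b s = (1 - s) + s * w v b := by simp only [hB]; ring
    rw [this]
    rcases eq_or_lt_of_le hs.1 with h | h
    · rw [← h]; norm_num
    · have := mul_pos h h1
      linarith [hs.2]
  set φ : Conf W → ℝ → ℝ := fun σ s => m σ * Real.exp (K⁻¹ * ∑ v, Real.log (B v (σ v) s)) with hφ
  set a : ℝ → W → Bool → ℝ := fun s v b => (w v b - 1) / B v b s with ha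
  have hBd : ∀ v b s, HasDerivAt (B v b) (w v b - 1) s := by
    intro v b s
    exact (((hasDerivAt_id s).mul_const (w v b - 1)).const_add 1).congr_deriv (one_mul _)
  have hφd : ∀ s ∈ Set.Icc (0:ℝ) 1, ∀ σ,
      HasDerivAt (φ σ) (φ σ s * (K⁻¹ * ∑ v, a s v (σ v))) s := by
    intro s hs σ
    have h1 : HasDerivAt (fun s => ∑ v, Real.log (B v (σ v) s)) (∑ v, a s v (σ v)) s :=
      HasDerivAt.fun_sum fun v _ => (hBd v (σ v) s).log (hBpos s hs v _).ne'
    have h2 := ((h1.const_mul K⁻¹).exp).const_mul (m σ)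
    refine h2.congr_deriv ?_
    simp only [hφ]; ring
  have had : ∀ s ∈ Set.Icc (0:ℝ) 1, ∀ σ : Conf W,
      HasDerivAt (fun s => ∑ v, a s v (σ v)) (-∑ v, (a s v (σ v)) ^ 2) s := by
    intro s hs σ
    rw [← Finset.sum_neg_distrib]
    refine HasDerivAt.fun_sum fun v _ => ?_
    have hne := (hBpos s hs v (σ v)).ne'
    have := (hasDerivAt_const s (w v (σ v) - 1)).div (hBd v (σ v) s) hne
    refine this.congr_deriv ?_
    simp only [ha]; field_simp; ring
  set Φ : ℝ → ℝ := fun s => ∑ σ, φ σ s with hΦ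
  set N : ℝ → ℝ := fun s => ∑ σ, φ σ s * ∑ v, a s v (σ v) with hN
  have hΦpos : ∀ s, 0 < Φ s := by
    intro s
    obtain ⟨σ, hσ⟩ : ∃ σ, 0 < m σ := by
      by_contra hcon; push Not at hcon
      exact absurd hZ (not_lt.2 (Finset.sum_nonpos fun σ _ => hcon σ))
    exact Finset.sum_pos' (fun σ _ => mul_nonneg (hm σ) (Real.exp_pos _).le)
      ⟨σ, Finset.mem_univ _, mul_pos hσ (Real.exp_pos _)⟩
  have hΦd : ∀ s ∈ Set.Icc (0:ℝ) 1, HasDerivAt Φ (K⁻¹ * N s) s := by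
    intro s hs
    have := HasDerivAt.fun_sum (u := Finset.univ) fun σ _ => hφd s hs σ
    refine this.congr_deriv ?_
    simp only [hN, Finset.mul_sum]
    refine Finset.sum_congr rfl fun σ _ => Finset.sum_congr rfl fun v _ => by ring
  have hNd : ∀ s ∈ Set.Icc (0:ℝ) 1, HasDerivAt N
      (K⁻¹ * (∑ σ, φ σ s * (∑ v, a s v (σ v)) ^ 2) - ∑ σ, φ σ s * ∑ v, (a s v (σ v)) ^ 2) s := by
    intro s hs
    have := HasDerivAt.fun_sum (u := Finset.univ) fun σ _ => (hφd s hs σ).mul (had s hs σ)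
    refine this.congr_deriv ?_
    rw [Finset.mul_sum, ← Finset.sum_sub_distrib]
    refine Finset.sum_congr rfl fun σ _ => by ring
  have hR : AntitoneOn (fun s => N s / Φ s) (Set.Icc 0 1) := by
    refine anti_of_hasDeriv (fun s hs => (hNd s hs).div (hΦd s hs) (hΦpos s).ne') ?_
    intro s hs
    apply div_nonpos_of_nonpos_of_nonneg _ (sq_nonneg _)
    have hq := hP (fun v b => Real.exp (K⁻¹ * Real.log (B v b s)))
      (fun v b => (Real.exp_pos _).le) (a s)
    have e : ∀ σ : Conf W, m σ * ∏ v, Real.exp (K⁻¹ * Real.log (B v (σ v) s)) = φ σ s := by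
      intro σ; simp only [hφ]; rw [← Real.exp_sum, Finset.mul_sum]
    simp only [e] at hq
    change Φ s * _ - (N s) ^ 2 ≤ K * (Φ s * _) at hq
    set Q := ∑ σ, φ σ s * (∑ v, a s v (σ v)) ^ 2
    set T := ∑ σ, φ σ s * ∑ v, (a s v (σ v)) ^ 2
    have : (K⁻¹ * Q - T) * Φ s - N s * (K⁻¹ * N s)
        = K⁻¹ * (Φ s * Q - N s ^ 2 - K * (Φ s * T)) := by
      field_simp; ring
    rw [this]
    exact mul_nonpos_of_nonneg_of_nonpos (inv_pos.2 hK).le (by linarith)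
  have hN0 : N 0 = 0 := by
    simp only [hN, hφ, ha, hB, zero_mul, add_zero, Real.log_one, Finset.sum_const_zero, mul_zero,
      Real.exp_zero, mul_one, div_one, Finset.mul_sum]
    rw [Finset.sum_comm]
    exact Finset.sum_eq_zero fun v _ => hb v
  have hNle : ∀ s ∈ Set.Icc (0:ℝ) 1, N s ≤ 0 := by
    intro s hs
    have := hR (Set.left_mem_Icc.2 zero_le_one) hs hs.1
    simp only [hN0, zero_div] at this
    by_contra hc
    exact absurd (div_pos (not_le.1 hc) (hΦpos s)) (not_lt.2 this)
  have hΦa : AntitoneOn Φ (Set.Icc 0 1) := anti_of_hasDeriv hΦd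
    fun s hs => mul_nonpos_of_nonneg_of_nonpos (inv_pos.2 hK).le (hNle s hs)
  have := hΦa (Set.left_mem_Icc.2 zero_le_one) (Set.right_mem_Icc.2 zero_le_one) zero_le_one
  simpa [hΦ, hφ, hB] using this

/-- unnormalized entropy -/
def uEnt (m f : Conf W → ℝ) : ℝ :=
  (∑ σ, m σ * (f σ * Real.log (f σ)))
    - (∑ σ, m σ * f σ) * Real.log ((∑ σ, m σ * f σ) / ∑ σ, m σ)

def res (m : Conf W → ℝ) (v : W) (b : Bool) : Conf W → ℝ :=
  fun σ => if σ v = b then m σ else 0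

lemma sum_res (m : Conf W → ℝ) (v : W) (g : Conf W → ℝ) :
    ∑ b, ∑ σ, res m v b σ * g σ = ∑ σ, m σ * g σ := by
  rw [Finset.sum_comm]
  refine Finset.sum_congr rfl fun σ _ => ?_
  simp only [res, ite_mul, zero_mul, Finset.sum_ite_eq, Finset.mem_univ, if_true]

lemma gibbs (m : Conf W → ℝ) (hm : ∀ σ, 0 ≤ m σ) (hZ : 0 < ∑ σ, m σ)
    (f : Conf W → ℝ) (hf : ∀ σ, 0 < f σ) (L : Conf W → ℝ)
    (hL : ∑ σ, m σ * Real.exp (L σ) ≤ ∑ σ, m σ) :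
    ∑ σ, m σ * f σ * L σ ≤ uEnt m f := by
  set Z := ∑ σ, m σ with hZd
  set F := ∑ σ, m σ * f σ with hF
  have hFpos : 0 < F := by
    obtain ⟨σ, hσ⟩ : ∃ σ, 0 < m σ := by
      by_contra hcon; push Not at hcon
      exact absurd hZ (not_lt.2 (Finset.sum_nonpos fun σ _ => hcon σ))
    exact Finset.sum_pos' (fun σ _ => mul_nonneg (hm σ) (hf σ).le)
      ⟨σ, Finset.mem_univ _, mul_pos hσ (hf σ)⟩
  have hc : 0 < F / Z := div_pos hFpos hZ
  have key : ∀ σ, m σ * f σ * (L σ - Real.log (f σ) + Real.log (F / Z))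
      ≤ (F / Z) * (m σ * Real.exp (L σ)) - m σ * f σ := by
    intro σ
    have h1 := Real.add_one_le_exp (L σ - Real.log (f σ) + Real.log (F / Z))
    rw [Real.exp_add, Real.exp_sub, Real.exp_log (hf σ), Real.exp_log hc] at h1
    have h2 := mul_le_mul_of_nonneg_left h1 (mul_nonneg (hm σ) (hf σ).le)
    have h3 : m σ * f σ * (Real.exp (L σ) / f σ * (F / Z)) = (F / Z) * (m σ * Real.exp (L σ)) := by
      have := (hf σ).ne'
      field_simp
    rw [h3] at h2
    linarith
  have hs := Finset.sum_le_sum fun σ (_ : σ ∈ Finset.univ) => key σ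
  rw [Finset.sum_sub_distrib, ← Finset.mul_sum] at hs
  have e : ∑ σ, m σ * f σ * (L σ - Real.log (f σ) + Real.log (F / Z))
      = (∑ σ, m σ * f σ * L σ) - (∑ σ, m σ * (f σ * Real.log (f σ))) + F * Real.log (F / Z) := by
    rw [hF, Finset.sum_mul, ← Finset.sum_sub_distrib, ← Finset.sum_add_distrib]
    refine Finset.sum_congr rfl fun σ _ => by ring
  rw [e] at hs
  have h4 : F / Z * ∑ σ, m σ * Real.exp (L σ) ≤ F / Z * Z := mul_le_mul_of_nonneg_left hL hc.le
  rw [div_mul_cancel₀ _ hZ.ne'] at h4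
  unfold uEnt
  rw [← hF, ← hZd]
  linarith

lemma uEnt_zero (f : Conf W → ℝ) (m : Conf W → ℝ) (h : ∀ σ, m σ = 0) : uEnt m f = 0 := by
  simp [uEnt, h]

lemma uEnt_nonneg (m : Conf W → ℝ) (hm : ∀ σ, 0 ≤ m σ)
    (f : Conf W → ℝ) (hf : ∀ σ, 0 < f σ) : 0 ≤ uEnt m f := by
  rcases eq_or_lt_of_le (Finset.sum_nonneg fun σ (_ : σ ∈ Finset.univ) => hm σ) with h | h
  · rw [uEnt_zero]
    intro σ
    exact (Finset.sum_eq_zero_iff_of_nonneg fun σ _ => hm σ).1 h.symm σ (Finset.mem_univ _)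
  · simpa using gibbs m hm h f hf (fun _ => 0) (by simp)

lemma EI (m : Conf W → ℝ) (hm : ∀ σ, 0 ≤ m σ) (K : ℝ) (hK : 0 < K) (hP : PQ m K)
    (f : Conf W → ℝ) (hf : ∀ σ, 0 < f σ) (T : Finset W) :
    ∑ v ∈ T, (uEnt m f - ∑ b, uEnt (res m v b) f) ≤ K * uEnt m f := by
  rcases eq_or_lt_of_le (Finset.sum_nonneg fun σ (_ : σ ∈ Finset.univ) => hm σ) with h | hZ
  · have h0 : ∀ σ, m σ = 0 := fun σ =>
      (Finset.sum_eq_zero_iff_of_nonneg fun σ _ => hm σ).1 h.symm σ (Finset.mem_univ _)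
    have h1 : ∀ v b, uEnt (res m v b) f = 0 := fun v b => uEnt_zero _ _ (by simp [res, h0])
    simp [h1, uEnt_zero f m h0]
  set Z := ∑ σ, m σ with hZd
  set F := ∑ σ, m σ * f σ with hF
  have hr0 : ∀ v b σ, 0 ≤ res m v b σ := by
    intro v b σ; unfold res; split_ifs; exacts [hm σ, le_rfl]
  set z : W → Bool → ℝ := fun v b => ∑ σ, res m v b σ with hz
  set q : W → Bool → ℝ := fun v b => ∑ σ, res m v b σ * f σ with hq
  have hpos : ∀ m' : Conf W → ℝ, (∀ σ, 0 ≤ m' σ) → 0 < ∑ σ, m' σ → 0 < ∑ σ, m' σ * f σ := by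
    intro m' hm' hZ'
    obtain ⟨σ, hσ⟩ : ∃ σ, 0 < m' σ := by
      by_contra hcon; push Not at hcon
      exact absurd hZ' (not_lt.2 (Finset.sum_nonpos fun σ _ => hcon σ))
    exact Finset.sum_pos' (fun σ _ => mul_nonneg (hm' σ) (hf σ).le)
      ⟨σ, Finset.mem_univ _, mul_pos hσ (hf σ)⟩
  have hFpos : 0 < F := hpos m hm hZ
  have hz0 : ∀ v b, 0 ≤ z v b := fun v b => Finset.sum_nonneg fun σ _ => hr0 v b σ
  have hqpos : ∀ v b, z v b ≠ 0 → 0 < q v b := fun v b hne =>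
    hpos _ (hr0 v b) (lt_of_le_of_ne (hz0 v b) hne.symm)
  have hqz : ∀ v b, z v b = 0 → q v b = 0 := by
    intro v b h0
    refine Finset.sum_eq_zero fun σ hσ => ?_
    rw [(Finset.sum_eq_zero_iff_of_nonneg fun σ _ => hr0 v b σ).1 h0 σ hσ, zero_mul]
  have hzs : ∀ v, ∑ b, z v b = Z := fun v => by
    simpa using sum_res m v (fun _ => 1)
  have hqs : ∀ v, ∑ b, q v b = F := fun v => sum_res m v f
  set w : W → Bool → ℝ := fun v b =>
    if v ∈ T ∧ z v b ≠ 0 then (q v b / z v b) / (F / Z) else 1 with hw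
  have hwpos : ∀ v b, 0 < w v b := by
    intro v b; simp only [hw]; split_ifs with hc
    · have := hqpos v b hc.2
      have := lt_of_le_of_ne (hz0 v b) hc.2.symm
      positivity
    · exact one_pos
  have hsplit : ∀ v (g : Bool → ℝ) (k : Conf W → ℝ), ∑ σ, m σ * k σ * g (σ v)
      = ∑ b, (∑ σ, res m v b σ * k σ) * g b := by
    intro v g k
    have := sum_res m v (fun σ => k σ * g (σ v))
    simp only [← mul_assoc] at this
    rw [← this]
    refine Finset.sum_congr rfl fun b _ => ?_
    rw [Finset.sum_mul]
    refine Finset.sum_congr rfl fun σ _ => ?_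
    unfold res; split_ifs with hb
    · rw [hb]
    · simp
  have hb : ∀ v, ∑ σ, m σ * (w v (σ v) - 1) = 0 := by
    intro v
    have := hsplit v (fun b => w v b - 1) (fun _ => 1)
    simp only [mul_one] at this
    rw [this]
    change ∑ b, z v b * (w v b - 1) = 0
    by_cases hv : v ∈ T
    · have : ∀ b, z v b * (w v b - 1) = q v b * (Z / F) - z v b := by
        intro b
        by_cases h0 : z v b = 0
        · rw [hqz v b h0, h0]; ring
        · simp only [hw]; rw [if_pos ⟨hv, h0⟩]; field_simp
      simp only [this]
      rw [Finset.sum_sub_distrib, ← Finset.sum_mul, hzs, hqs]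
      field_simp; ring
    · simp [hw, hv]
  have ht := tilt_le m hm hZ K hK hP w hwpos hb
  have hg := gibbs m hm hZ f hf _ ht
  have hve : ∀ v ∈ T, uEnt m f - ∑ b, uEnt (res m v b) f
      = ∑ σ, m σ * f σ * Real.log (w v (σ v)) := by
    intro v hv
    rw [hsplit v (fun b => Real.log (w v b)) f]
    change _ = ∑ b, q v b * Real.log (w v b)
    have h1 : ∀ b, q v b * Real.log (w v b)
        = q v b * Real.log (q v b / z v b) - q v b * Real.log (F / Z) := by
      intro b
      by_cases h0 : z v b = 0
      · rw [hqz v b h0]; ring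
      · simp only [hw]; rw [if_pos ⟨hv, h0⟩]
        have h2 := hqpos v b h0
        rw [Real.log_div (div_ne_zero h2.ne' h0) (div_pos hFpos hZ).ne']; ring
    simp only [h1]
    rw [Finset.sum_sub_distrib, ← Finset.sum_mul, hqs]
    unfold uEnt
    rw [Finset.sum_sub_distrib, sum_res m v (fun σ => f σ * Real.log (f σ))]
    ring
  rw [Finset.sum_congr rfl hve]
  have hout : ∀ v, v ∉ T → ∑ σ, m σ * f σ * Real.log (w v (σ v)) = 0 := by
    intro v hv; simp [hw, hv]
  have : ∑ σ, m σ * f σ * (K⁻¹ * ∑ v, Real.log (w v (σ v)))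
      = K⁻¹ * ∑ v ∈ T, ∑ σ, m σ * f σ * Real.log (w v (σ v)) := by
    rw [Finset.sum_subset (Finset.subset_univ T) (fun v _ hv => hout v hv), Finset.sum_comm,
      Finset.mul_sum]
    refine Finset.sum_congr rfl fun σ _ => ?_
    rw [← Finset.mul_sum]; ring
  rw [this] at hg
  have := mul_le_mul_of_nonneg_left hg hK.le
  rwa [mul_inv_cancel_left₀ hK.ne'] at this

def agr (m : Conf W → ℝ) (S : Finset W) (χ : Conf W) : Conf W → ℝ :=
  fun σ => if ∀ v ∈ Finset.univ \ S, σ v = χ v then m σ else 0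

lemma agr_nonneg (m : Conf W → ℝ) (hm : ∀ σ, 0 ≤ m σ) (S : Finset W) (χ σ : Conf W) :
    0 ≤ agr m S χ σ := by
  unfold agr; split_ifs; exacts [hm σ, le_rfl]

lemma PQ_agr {m : Conf W → ℝ} {K : ℝ} (h : PQ m K) (S : Finset W) (χ : Conf W) :
    PQ (agr m S χ) K := by
  have h1 := PQ_mul h (fun v b => if v ∈ S ∨ b = χ v then 1 else 0)
    (fun v b => by split_ifs <;> norm_num)
  have h2 : (fun σ : Conf W => m σ * ∏ v, (if v ∈ S ∨ σ v = χ v then (1:ℝ) else 0)) = agr m S χ := by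
    funext σ
    unfold agr
    split_ifs with hc
    · rw [Finset.prod_eq_one, mul_one]
      intro v _
      by_cases hv : v ∈ S
      · simp [hv]
      · simp [hc v (by simp [hv])]
    · push Not at hc
      obtain ⟨v, hv, hne⟩ := hc
      rw [Finset.prod_eq_zero (Finset.mem_univ v), mul_zero]
      have : v ∉ S := by simpa using hv
      simp [this, hne]
  rw [← h2]; exact h1

lemma avgEnt_eq (ν : Conf W → ℝ) (hν : ∀ σ, 0 ≤ ν σ) (S : Finset W) (f : Conf W → ℝ) :
    avgEnt ν S f = ∑ χ : Conf W, if ∀ v ∈ S, χ v = false then uEnt (agr ν S χ) f else 0 := by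
  unfold avgEnt
  refine Finset.sum_congr rfl fun χ _ => ?_
  split_ifs with h
  swap
  · rfl
  have hM : margin ν (Finset.univ \ S) χ = ∑ σ, agr ν S χ σ := rfl
  have hc : ∀ σ, condDist ν (Finset.univ \ S) χ σ = agr ν S χ σ / ∑ σ, agr ν S χ σ := by
    intro σ
    unfold condDist
    rw [hM]
    conv_rhs => rw [agr]
    split_ifs
    · rfl
    · simp
  rw [hM]
  set M := ∑ σ, agr ν S χ σ with hMd
  by_cases h0 : M = 0
  · rw [h0, zero_mul, uEnt_zero]
    intro σ
    exact (Finset.sum_eq_zero_iff_of_nonneg fun σ _ => agr_nonneg ν hν S χ σ).1 h0 σ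
      (Finset.mem_univ _)
  · unfold entOf uEnt
    simp only [hc, div_mul_eq_mul_div]
    rw [← Finset.sum_div, ← Finset.sum_div, ← hMd]
    field_simp

lemma avgEnt_nonneg (ν : Conf W → ℝ) (hν : ∀ σ, 0 ≤ ν σ) (S : Finset W) (f : Conf W → ℝ)
    (hf : ∀ σ, 0 < f σ) : 0 ≤ avgEnt ν S f := by
  rw [avgEnt_eq ν hν]
  refine Finset.sum_nonneg fun χ _ => ?_
  split_ifs
  · exact uEnt_nonneg _ (agr_nonneg ν hν S χ) f hf
  · exact le_rfl

lemma avgEnt_univ (ν : Conf W → ℝ) (hν : IsDist ν) (f : Conf W → ℝ) :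
    avgEnt ν Finset.univ f = entOf ν f := by
  rw [avgEnt_eq ν hν.1, Finset.sum_eq_single (fun _ => false)]
  · have : agr ν Finset.univ (fun _ => false) = ν := by
      funext σ; simp [agr]
    simp [this, uEnt, entOf, hν.2]
  · intro χ _ hne
    rw [if_neg]
    intro h
    exact hne (funext fun v => h v (Finset.mem_univ v))
  · simp

lemma sum_erase_conf (S : Finset W) (v : W) (hv : v ∈ S) (g : Conf W → ℝ) :
    (∑ χ : Conf W, if ∀ u ∈ S.erase v, χ u = false then g χ else 0)
      = ∑ χ : Conf W, if ∀ u ∈ S, χ u = false then ∑ b, g (Function.update χ v b) else 0 := by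
  rw [← Finset.sum_filter, ← Finset.sum_filter, Finset.sum_sigma']
  refine Finset.sum_nbij' (fun χ => ⟨Function.update χ v false, χ v⟩)
    (fun x => Function.update x.1 v x.2) ?_ ?_ ?_ ?_ ?_
  · intro χ h
    simp only [Finset.mem_filter, Finset.mem_univ, true_and, Finset.mem_sigma, and_true] at h ⊢
    intro u hu
    by_cases huv : u = v
    · subst huv; simp
    · rw [Function.update_of_ne huv]; exact h u (Finset.mem_erase.2 ⟨huv, hu⟩)
  · rintro ⟨χ, b⟩ h
    simp only [Finset.mem_filter, Finset.mem_univ, true_and, Finset.mem_sigma, and_true] at h ⊢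
    intro u hu
    rw [Function.update_of_ne (Finset.ne_of_mem_erase hu)]
    exact h u (Finset.mem_of_mem_erase hu)
  · intro χ _; simp
  · rintro ⟨χ, b⟩ h
    simp only [Finset.mem_filter, Finset.mem_univ, true_and, Finset.mem_sigma, and_true] at h
    have : Function.update χ v false = χ := by rw [← h v hv]; simp
    simp [this]
  · intro χ _; simp

lemma avgEnt_erase (ν : Conf W → ℝ) (hν : ∀ σ, 0 ≤ ν σ) (S : Finset W) (f : Conf W → ℝ)
    (v : W) (hv : v ∈ S) :
    avgEnt ν (S.erase v) f = ∑ χ : Conf W, if ∀ u ∈ S, χ u = false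
      then ∑ b, uEnt (res (agr ν S χ) v b) f else 0 := by
  rw [avgEnt_eq ν hν, sum_erase_conf S v hv]
  refine Finset.sum_congr rfl fun χ _ => ?_
  congr 1
  refine Finset.sum_congr rfl fun b _ => ?_
  congr 1
  funext σ
  simp only [agr, res]
  have : (∀ u ∈ Finset.univ \ S.erase v, σ u = Function.update χ v b u)
      ↔ (σ v = b ∧ ∀ u ∈ Finset.univ \ S, σ u = χ u) := by
    constructor
    · intro h
      refine ⟨by simpa using h v (by simp), fun u hu => ?_⟩
      have huS : u ∉ S := by simpa using hu
      have huv : u ≠ v := fun e => huS (e ▸ hv)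
      simpa [huv] using h u (by simp [huS])
    · rintro ⟨h1, h2⟩ u hu
      by_cases huv : u = v
      · subst huv; simp [h1]
      · rw [Function.update_of_ne huv]
        apply h2
        simp only [Finset.mem_sdiff, Finset.mem_univ, Finset.mem_erase, true_and] at hu ⊢
        exact fun h => hu ⟨huv, h⟩
  by_cases h1 : σ v = b <;> by_cases h2 : ∀ u ∈ Finset.univ \ S, σ u = χ u
  · rw [if_pos (this.2 ⟨h1, h2⟩), if_pos h1, if_pos h2]
  · rw [if_neg (fun h => h2 (this.1 h).2), if_pos h1, if_neg h2]
  · rw [if_neg (fun h => h1 (this.1 h).1), if_neg h1]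
  · rw [if_neg (fun h => h1 (this.1 h).1), if_neg h1]

lemma block_step (ν : Conf W → ℝ) (hν : ∀ σ, 0 ≤ ν σ) (K : ℝ) (hK : 0 < K) (hP : PQ ν K)
    (f : Conf W → ℝ) (hf : ∀ σ, 0 < f σ) (S : Finset W) :
    ((S.card : ℝ) - K) * avgEnt ν S f ≤ ∑ v ∈ S, avgEnt ν (S.erase v) f := by
  have h1 : ∑ v ∈ S, (avgEnt ν S f - avgEnt ν (S.erase v) f) ≤ K * avgEnt ν S f := by
    have h2 : ∀ v ∈ S, avgEnt ν S f - avgEnt ν (S.erase v) f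
        = ∑ χ : Conf W, if ∀ u ∈ S, χ u = false
          then uEnt (agr ν S χ) f - ∑ b, uEnt (res (agr ν S χ) v b) f else 0 := by
      intro v hv
      rw [avgEnt_erase ν hν S f v hv, avgEnt_eq ν hν, ← Finset.sum_sub_distrib]
      refine Finset.sum_congr rfl fun χ _ => ?_
      split_ifs <;> simp
    rw [Finset.sum_congr rfl h2, Finset.sum_comm, avgEnt_eq ν hν, Finset.mul_sum]
    refine Finset.sum_le_sum fun χ _ => ?_
    split_ifs
    · exact EI _ (agr_nonneg ν hν S χ) K hK (PQ_agr hP S χ) f hf S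
    · simp
  rw [Finset.sum_sub_distrib, Finset.sum_const, nsmul_eq_mul] at h1
  linarith

lemma double_count (j : ℕ) (g : Finset W → ℝ) :
    ∑ S ∈ Finset.powersetCard (j + 1) (Finset.univ : Finset W), ∑ v ∈ S, g (S.erase v)
      = ((Fintype.card W - j : ℕ) : ℝ) * ∑ T ∈ Finset.powersetCard j (Finset.univ : Finset W), g T := by
  have : ((Fintype.card W - j : ℕ) : ℝ) * ∑ T ∈ Finset.powersetCard j (Finset.univ : Finset W), g T
      = ∑ T ∈ Finset.powersetCard j (Finset.univ : Finset W), ∑ v ∈ Tᶜ, g T := by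
    rw [Finset.mul_sum]
    refine Finset.sum_congr rfl fun T hT => ?_
    rw [Finset.sum_const, nsmul_eq_mul, Finset.card_compl, (Finset.mem_powersetCard.1 hT).2]
  rw [this, Finset.sum_sigma', Finset.sum_sigma']
  refine Finset.sum_nbij' (fun x => ⟨x.1.erase x.2, x.2⟩) (fun x => ⟨insert x.2 x.1, x.2⟩)
    ?_ ?_ ?_ ?_ ?_
  · rintro ⟨S, v⟩ h
    simp only [Finset.mem_sigma, Finset.mem_powersetCard, Finset.subset_univ, true_and] at h ⊢
    refine ⟨by rw [Finset.card_erase_of_mem h.2, h.1]; rfl, by simp⟩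
  · rintro ⟨S, v⟩ h
    simp only [Finset.mem_sigma, Finset.mem_powersetCard, Finset.subset_univ, true_and,
      Finset.mem_compl] at h ⊢
    refine ⟨by rw [Finset.card_insert_of_notMem h.2, h.1], by simp⟩
  · rintro ⟨S, v⟩ h
    simp only [Finset.mem_sigma] at h
    simp [Finset.insert_erase h.2]
  · rintro ⟨S, v⟩ h
    simp only [Finset.mem_sigma, Finset.mem_compl] at h
    simp [Finset.erase_insert h.2]
  · intro x _; rfl

def avgB (ν f : Conf W → ℝ) (j : ℕ) : ℝ :=
  (∑ S ∈ Finset.powersetCard j (Finset.univ : Finset W), avgEnt ν S f) /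
    (Nat.choose (Fintype.card W) j : ℝ)

lemma avgB_nonneg (ν : Conf W → ℝ) (hν : ∀ σ, 0 ≤ ν σ) (f : Conf W → ℝ) (hf : ∀ σ, 0 < f σ) (j : ℕ) :
    0 ≤ avgB ν f j :=
  div_nonneg (Finset.sum_nonneg fun S _ => avgEnt_nonneg ν hν S f hf) (Nat.cast_nonneg _)

lemma avgB_step (ν : Conf W → ℝ) (hν : ∀ σ, 0 ≤ ν σ) (K : ℝ) (hK : 0 < K) (hP : PQ ν K)
    (f : Conf W → ℝ) (hf : ∀ σ, 0 < f σ) (j : ℕ) (hj : j + 1 ≤ Fintype.card W) :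
    ((j + 1 : ℝ) - K) * avgB ν f (j + 1) ≤ (j + 1) * avgB ν f j := by
  set N := Fintype.card W with hN
  have h1 := Finset.sum_le_sum fun S (hS : S ∈ Finset.powersetCard (j + 1) (Finset.univ : Finset W)) =>
    block_step ν hν K hK hP f hf S
  rw [double_count j (fun T => avgEnt ν T f)] at h1
  have h2 : ∑ S ∈ Finset.powersetCard (j + 1) (Finset.univ : Finset W),
      ((S.card : ℝ) - K) * avgEnt ν S f = ((j + 1 : ℝ) - K) *
      ∑ S ∈ Finset.powersetCard (j + 1) (Finset.univ : Finset W), avgEnt ν S f := by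
    rw [Finset.mul_sum]
    refine Finset.sum_congr rfl fun S hS => ?_
    rw [(Finset.mem_powersetCard.1 hS).2]; push_cast; rfl
  rw [h2] at h1
  have hch : ((N.choose (j + 1) : ℕ) : ℝ) * (j + 1) = (N.choose j : ℝ) * ((N - j : ℕ) : ℝ) := by
    exact_mod_cast Nat.choose_succ_right_eq N j
  have c1 : (0:ℝ) < N.choose j := by exact_mod_cast Nat.choose_pos (by omega)
  have c2 : (0:ℝ) < N.choose (j + 1) := by exact_mod_cast Nat.choose_pos hj
  unfold avgB
  rw [← hN]
  set M1 := ∑ S ∈ Finset.powersetCard (j + 1) (Finset.univ : Finset W), avgEnt ν S f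
  set M0 := ∑ S ∈ Finset.powersetCard j (Finset.univ : Finset W), avgEnt ν S f
  rw [← mul_div_assoc, ← mul_div_assoc, div_le_div_iff₀ c2 c1]
  have h3 := mul_le_mul_of_nonneg_right h1 c1.le
  calc _ ≤ _ := h3
    _ = M0 * ((N.choose j : ℝ) * ((N - j : ℕ) : ℝ)) := by ring
    _ = _ := by rw [← hch]; ring

lemma avgB_chain (ν : Conf W → ℝ) (hν : ∀ σ, 0 ≤ ν σ) (K : ℝ) (hK : 0 < K) (hP : PQ ν K)
    (f : Conf W → ℝ) (hf : ∀ σ, 0 < f σ) (r ℓ : ℕ) (hr : K ≤ r) (hrl : r ≤ ℓ) (j : ℕ) (hj : ℓ ≤ j) :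
    j ≤ Fintype.card W →
    avgB ν f j * (ℓ.choose r : ℝ) ≤ (j.choose r : ℝ) * avgB ν f ℓ := by
  induction j, hj using Nat.le_induction with
  | base => intro _; rw [mul_comm]
  | succ j hj ih =>
    intro hjN
    have ih := ih (by omega)
    have hs := avgB_step ν hν K hK hP f hf j hjN
    have hn := avgB_nonneg ν hν f hf (j + 1)
    have hpos : (0:ℝ) < (j:ℝ) + 1 - r := by
      have : (r:ℝ) ≤ j := by exact_mod_cast hrl.trans hj
      linarith
    have hch : ((j + 1).choose r : ℝ) * ((j:ℝ) + 1 - r) = (j.choose r : ℝ) * (j + 1) := by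
      have := Nat.choose_mul_succ_eq j r
      have h2 : ((j + 1 - r : ℕ) : ℝ) = (j:ℝ) + 1 - r := by
        rw [Nat.cast_sub (by omega)]; push_cast; rfl
      rw [← h2]; exact_mod_cast this.symm
    have hs' : ((j:ℝ) + 1 - r) * avgB ν f (j + 1) ≤ (j + 1) * avgB ν f j :=
      le_trans (mul_le_mul_of_nonneg_right (by linarith) hn) hs
    refine le_of_mul_le_mul_right ?_ hpos
    calc avgB ν f (j + 1) * (ℓ.choose r : ℝ) * ((j:ℝ) + 1 - r)
        = (((j:ℝ) + 1 - r) * avgB ν f (j + 1)) * (ℓ.choose r : ℝ) := by ring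
      _ ≤ ((j + 1) * avgB ν f j) * (ℓ.choose r : ℝ) :=
          mul_le_mul_of_nonneg_right hs' (Nat.cast_nonneg _)
      _ = (j + 1) * (avgB ν f j * (ℓ.choose r : ℝ)) := by ring
      _ ≤ (j + 1) * ((j.choose r : ℝ) * avgB ν f ℓ) :=
          mul_le_mul_of_nonneg_left ih (by positivity)
      _ = ((j.choose r : ℝ) * (j + 1)) * avgB ν f ℓ := by ring
      _ = _ := by rw [← hch]; ring

lemma avgB_top (ν : Conf W → ℝ) (hν : IsDist ν) (f : Conf W → ℝ) :
    avgB ν f (Fintype.card W) = entOf ν f := by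
  unfold avgB
  have : Finset.powersetCard (Fintype.card W) (Finset.univ : Finset W) = {Finset.univ} :=
    Finset.powersetCard_self _
  rw [this]; simp [avgEnt_univ ν hν]

lemma ubf_of_pos (ν : Conf W → ℝ) (ℓ : ℕ) (C : ℝ)
    (h : ∀ f : Conf W → ℝ, (∀ σ, 0 < f σ) → entOf ν f ≤ C * avgB ν f ℓ) : UBF ν ℓ C := by
  intro f hf
  have ce : ∀ ν' : Conf W → ℝ, Continuous (fun ε : ℝ => entOf ν' (fun σ => f σ + ε)) := by
    intro ν'
    unfold entOf
    have h1 : ∀ σ, Continuous (fun ε : ℝ => (f σ + ε) * Real.log (f σ + ε)) := fun σ =>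
      Real.continuous_mul_log.comp (continuous_const.add continuous_id)
    have h2 : Continuous (fun ε : ℝ => (∑ a, ν' a * (f a + ε)) * Real.log (∑ a, ν' a * (f a + ε))) :=
      Real.continuous_mul_log.comp (by fun_prop)
    exact (continuous_finsetSum _ fun σ _ => continuous_const.mul (h1 σ)).sub h2
  have ca : ∀ S, Continuous (fun ε : ℝ => avgEnt ν S (fun σ => f σ + ε)) := by
    intro S
    unfold avgEnt
    refine continuous_finsetSum _ fun χ _ => ?_
    split_ifs
    · exact continuous_const.mul (ce _)
    · exact continuous_const
  have cb : Continuous (fun ε : ℝ => C * avgB ν (fun σ => f σ + ε) ℓ) := by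
    unfold avgB
    exact continuous_const.mul ((continuous_finsetSum _ fun S _ => ca S).div_const _)
  have t1 := ((ce ν).tendsto 0).mono_left (nhdsWithin_le_nhds (s := Set.Ioi 0))
  have t2 := (cb.tendsto 0).mono_left (nhdsWithin_le_nhds (s := Set.Ioi 0))
  have := le_of_tendsto_of_tendsto t1 t2 (by
    filter_upwards [self_mem_nhdsWithin] with ε hε
    exact h _ (fun σ => add_pos_of_nonneg_of_pos (hf σ) hε))
  simp only [add_zero] at this
  refine this.trans (le_of_eq ?_)
  unfold avgB; ring

lemma choose_ratio (N ℓ r : ℕ) (θ : ℝ) (hθ : 0 < θ) (hl : 0 < ℓ) (hrl : r ≤ ℓ) (hN : θ * N ≤ ℓ) :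
    (N.choose r : ℝ) ≤ (Real.exp 1 / θ) ^ r * (ℓ.choose r : ℝ) := by
  have h1 : (N.choose r : ℝ) ≤ (N:ℝ) ^ r / (r.factorial : ℝ) := Nat.choose_le_pow_div r N
  have h2 : ((ℓ:ℝ)) ^ r ≤ (r:ℝ) ^ r * (ℓ.choose r : ℝ) := by
    have key : ∀ r ℓ : ℕ, r ≤ ℓ → ℓ ^ r ≤ r ^ r * ℓ.choose r := by
      intro r ℓ hl
      have h1 : ∏ i ∈ Finset.range r, ℓ * (r - i) ≤ ∏ i ∈ Finset.range r, r * (ℓ - i) := by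
        refine Finset.prod_le_prod' fun i hi => ?_
        have hi := Finset.mem_range.1 hi
        rw [Nat.mul_sub, Nat.mul_sub, mul_comm ℓ r]
        exact Nat.sub_le_sub_left (Nat.mul_le_mul_right i hl) _
      rw [Finset.prod_mul_distrib, Finset.prod_mul_distrib, Finset.prod_const, Finset.prod_const,
        Finset.card_range, ← Nat.descFactorial_eq_prod_range, ← Nat.descFactorial_eq_prod_range,
        Nat.descFactorial_self, Nat.descFactorial_eq_factorial_mul_choose] at h1
      refine Nat.le_of_mul_le_mul_right (c := r.factorial) ?_ r.factorial_pos
      refine h1.trans (le_of_eq (by ring))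
    exact_mod_cast key r ℓ hrl
  have h3 : (r:ℝ) ^ r / (r.factorial : ℝ) ≤ Real.exp r := Real.pow_div_factorial_le_exp _ (Nat.cast_nonneg _) r
  have hf : (0:ℝ) < r.factorial := by exact_mod_cast r.factorial_pos
  have h4 : (N:ℝ) ^ r ≤ (ℓ / θ) ^ r := by
    apply pow_le_pow_left₀ (Nat.cast_nonneg _)
    rw [le_div_iff₀ hθ]; linarith
  calc (N.choose r : ℝ) ≤ (N:ℝ) ^ r / (r.factorial : ℝ) := h1
    _ ≤ (ℓ / θ) ^ r / (r.factorial : ℝ) := by gcongr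
    _ = (1 / θ) ^ r * ((ℓ:ℝ) ^ r) / (r.factorial : ℝ) := by rw [← mul_pow]; congr 2; ring
    _ ≤ (1 / θ) ^ r * ((r:ℝ) ^ r * (ℓ.choose r : ℝ)) / (r.factorial : ℝ) := by gcongr
    _ = (1 / θ) ^ r * ((r:ℝ) ^ r / (r.factorial : ℝ)) * (ℓ.choose r : ℝ) := by ring
    _ ≤ (1 / θ) ^ r * Real.exp r * (ℓ.choose r : ℝ) := by gcongr
    _ = _ := by
      rw [← Real.exp_one_pow, ← mul_pow]; congr 2; ring

lemma ktrans_dist {V : Type*} [Fintype V] [DecidableEq V] (μ : Conf V → ℝ) (hμ : IsDist μ)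
    (k : ℕ) (hk : 0 < k) : IsDist (ktrans μ k) := by
  refine ⟨fun τ => ?_, ?_⟩
  · unfold ktrans; split_ifs
    · exact mul_nonneg (hμ.1 _) (by positivity)
    · exact le_rfl
  set q : Bool → (Fin k → Bool) → ℝ := fun b t =>
    if (Finset.univ.filter (fun i : Fin k => t i = true)).card ≤ 1 ∧ decide (∃ i, t i = true) = b
    then (if b = true then (k:ℝ)⁻¹ else 1) else 0 with hq
  have h1 : ∀ τ : Conf (V × Fin k), ktrans μ k τ = ∑ σ, μ σ * ∏ v, q (σ v) (fun i => τ (v, i)) := by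
    intro τ
    rw [Finset.sum_eq_single (kstar τ)]
    · unfold ktrans
      split_ifs with h
      · congr 1
        have : ∀ v, q (kstar τ v) (fun i => τ (v, i)) = if kstar τ v = true then (k:ℝ)⁻¹ else 1 := by
          intro v; simp only [hq]
          rw [if_pos ⟨h v, rfl⟩]
        simp only [this]
        rw [Finset.prod_ite]
        simp [plusCount, plusSet]
      · push Not at h
        obtain ⟨v, hv⟩ := h
        rw [Finset.prod_eq_zero (Finset.mem_univ v), mul_zero]
        simp only [hq]
        rw [if_neg]
        rintro ⟨h1, -⟩
        omega
    · intro σ _ hne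
      obtain ⟨v, hv⟩ : ∃ v, σ v ≠ kstar τ v := by
        by_contra hc; push Not at hc; exact hne (funext hc)
      rw [Finset.prod_eq_zero (Finset.mem_univ v), mul_zero]
      simp only [hq]
      rw [if_neg]
      rintro ⟨-, h2⟩
      exact hv h2.symm
    · simp
  have hqs : ∀ b, ∑ t, q b t = 1 := by
    intro b
    cases b
    · rw [Finset.sum_eq_single (fun _ => false)]
      · simp [hq]
      · intro t _ hne
        simp only [hq]
        rw [if_neg]
        rintro ⟨-, h2⟩
        apply hne
        funext i
        simp only [decide_eq_false_iff_not, not_exists] at h2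
        simpa using h2 i
      · simp
    · have : ∀ t, q true t = ∑ i : Fin k, if t = (fun j => decide (j = i)) then (k:ℝ)⁻¹ else 0 := by
        intro t
        simp only [hq]
        split_ifs with h
        · obtain ⟨hc, he⟩ := h
          simp only [decide_eq_true_eq] at he
          obtain ⟨i, hi⟩ := he
          have hu : t = fun j => decide (j = i) := by
            funext j
            by_cases hj : j = i
            · subst hj; simp [hi]
            · simp only [hj, decide_false]
              by_contra hne
              have hne : t j = true := by simpa using hne
              exact hj (Finset.card_le_one.1 hc j (by simp [hne]) i (by simp [hi]))
          rw [Finset.sum_eq_single i]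
          · rw [if_pos hu]
          · intro i' _ hne
            rw [if_neg]
            intro h'
            rw [h'] at hi
            simp at hi
            exact hne hi.symm
          · simp
        · symm
          refine Finset.sum_eq_zero fun i _ => ?_
          rw [if_neg]
          rintro rfl
          apply h
          refine ⟨?_, by simp⟩
          rw [Finset.card_le_one]
          intro a ha b hb
          simp at ha hb
          rw [ha, hb]
      simp only [this]
      rw [Finset.sum_comm]
      simp
      field_simp
  have h2 : ∀ σ : Conf V, ∑ τ : Conf (V × Fin k), ∏ v, q (σ v) (fun i => τ (v, i)) = 1 := by
    intro σ
    rw [← (Equiv.curry V (Fin k) Bool).symm.sum_comp]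
    have := Finset.prod_univ_sum (fun _ : V => (Finset.univ : Finset (Fin k → Bool)))
      (fun v t => q (σ v) t)
    simp only [hqs, Finset.prod_const_one, Fintype.piFinset_univ] at this
    exact this.symm
  simp only [h1]
  rw [Finset.sum_comm]
  simp only [← Finset.mul_sum, h2, mul_one]
  exact hμ.2

end KT

/-- For every integer `k > (η+2)/(θn)`, if `μ_k = Trans(μ,k)` is
`η`-spectrally independent in `∞`-norm with all fields, then `μ_k` satisfies
`⌈θkn⌉`-uniform block factorization of entropy with parameter `C = (e/θ)^{η+2}`. -/
theorem ktrans_si_implies_ubf {V : Type*} [Fintype V] [DecidableEq V]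
    (μ : Conf V → ℝ) (hμ : IsDist μ) (η : ℝ) (hη : 0 < η)
    (θ : ℝ) (hθ : 0 < θ) (hθ1 : θ < 1) (k : ℕ)
    (hk : (η + 2) / (θ * (Fintype.card V : ℝ)) < (k : ℝ))
    (hSI : SIinfAllFields (ktrans μ k) η) :
    UBF (ktrans μ k) (⌈θ * (k : ℝ) * (Fintype.card V : ℝ)⌉₊)
      ((Real.exp 1 / θ) ^ (η + 2)) := by
  rcases Nat.eq_zero_or_pos k with hk0 | hkpos
  · exfalso
    rw [hk0, Nat.cast_zero] at hk
    exact absurd hk (not_lt.2 (by positivity))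
  have hdist := KT.ktrans_dist μ hμ k hkpos
  have hPQ := KT.PQ_of_SI (ktrans μ k) hdist η hSI
  have hbase : 1 ≤ Real.exp 1 / θ := by
    rw [le_div_iff₀ hθ]
    have := Real.add_one_le_exp (1:ℝ)
    linarith
  have hcard : Fintype.card (V × Fin k) = Fintype.card V * k := by simp
  apply KT.ubf_of_pos
  intro f hf
  set ℓ := ⌈θ * (k : ℝ) * (Fintype.card V : ℝ)⌉₊ with hℓ
  set N := Fintype.card (V × Fin k) with hN
  have hNr : (N : ℝ) = (k:ℝ) * (Fintype.card V : ℝ) := by rw [hcard]; push_cast; ring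
  rw [← KT.avgB_top (ktrans μ k) hdist f, ← hN]
  have hB := fun j => KT.avgB_nonneg (ktrans μ k) hdist.1 f hf j
  rcases Nat.eq_zero_or_pos (Fintype.card V) with hV | hV
  · have h1 : N = 0 := by rw [hcard, hV, zero_mul]
    have h2 : ℓ = 0 := by rw [hℓ, hV]; simp
    rw [h1, h2]
    exact le_mul_of_one_le_left (hB 0) (Real.one_le_rpow hbase (by linarith))
  have hVr : (0:ℝ) < Fintype.card V := by exact_mod_cast hV
  rw [div_lt_iff₀ (by positivity)] at hk
  have hθN : θ * N = θ * (k : ℝ) * (Fintype.card V : ℝ) := by rw [hNr]; ring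
  have hlow : θ * N ≤ ℓ := by rw [hθN]; exact Nat.le_ceil _
  have hℓη : η + 2 < ℓ := by
    refine lt_of_lt_of_le (lt_of_lt_of_eq hk ?_) hlow
    rw [hNr]; ring
  have hℓN : ℓ ≤ N := by
    rw [hℓ, ← hθN]
    apply Nat.ceil_le.2
    have : (0:ℝ) ≤ N := Nat.cast_nonneg _
    nlinarith
  set r := ⌈η + 1⌉₊ with hr
  have hr1 : η + 1 ≤ r := Nat.le_ceil _
  have hr2 : (r:ℝ) < η + 2 := by
    have := Nat.ceil_lt_add_one (show (0:ℝ) ≤ η + 1 by linarith)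
    linarith
  have hrl : r ≤ ℓ := by
    have : (r:ℝ) ≤ ℓ := by linarith
    exact_mod_cast this
  have hch := KT.avgB_chain (ktrans μ k) hdist.1 (η + 1) (by linarith) hPQ f hf r ℓ hr1 hrl N hℓN le_rfl
  have hl0 : 0 < ℓ := by
    have : (0:ℝ) < ℓ := by linarith
    exact_mod_cast this
  have hcr := KT.choose_ratio N ℓ r θ hθ hl0 hrl hlow
  have hpow : (Real.exp 1 / θ) ^ r ≤ (Real.exp 1 / θ) ^ (η + 2) := by
    rw [← Real.rpow_natCast]
    exact Real.rpow_le_rpow_of_exponent_le hbase hr2.le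
  have hc0 : (0:ℝ) < ℓ.choose r := by exact_mod_cast Nat.choose_pos hrl
  refine le_of_mul_le_mul_right ?_ hc0
  calc _ ≤ _ := hch
    _ ≤ ((Real.exp 1 / θ) ^ (η + 2) * (ℓ.choose r : ℝ)) * KT.avgB (ktrans μ k) f ℓ := by
        apply mul_le_mul_of_nonneg_right _ (hB ℓ)
        exact hcr.trans (mul_le_mul_of_nonneg_right hpow hc0.le)
    _ = _ := by ring
end
end

section
/- Let μ be a distribution over {-1,+1}^V with n = |V|, let θ ∈ (0,1) and C > 0. If there is a finite k_0 such that for all integers k ≥ k_0 the k-transformed distribution μ_k = Trans(μ, k) satisfies ⌈θkn⌉-uniform block factorization of entropy with parameter C, then μ satisfies θ-magnetized block factorization of entropy with parameter C. -/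
open Classical Finset

noncomputable section

open PaperIsing

/-- Homogeneous entropy of a finite nonnegative weight. -/
def hE {A : Type*} [Fintype A] (w f : A → ℝ) : ℝ :=
  (∑ a, w a * (f a * Real.log (f a))) -
    (∑ a, w a * f a) * Real.log ((∑ a, w a * f a) / ∑ a, w a)

lemma hE_smul {A : Type*} [Fintype A] (c : ℝ) (w f : A → ℝ) :
    hE (fun a => c * w a) f = c * hE w f := by
  by_cases hc : c = 0
  · simp [hE, hc]
  · simp only [hE, mul_assoc, ← Finset.mul_sum]
    rw [mul_div_mul_left _ _ hc]
    ring

lemma hE_zero {A : Type*} [Fintype A] (f : A → ℝ) : hE (fun _ => 0) f = 0 := by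
  simp [hE]

lemma hE_push {A B : Type*} [Fintype A] [Fintype B] [DecidableEq B] (g : A → B) (w : A → ℝ) (f : B → ℝ) :
    hE w (fun a => f (g a)) = hE (fun b => ∑ a, if g a = b then w a else 0) f := by
  have key : ∀ φ : B → ℝ, ∑ b, (∑ a, if g a = b then w a else 0) * φ b = ∑ a, w a * φ (g a) := by
    intro φ
    simp only [Finset.sum_mul, ite_mul, zero_mul]
    rw [Finset.sum_comm]
    simp
  have k1 := key (fun _ => 1)
  simp only [mul_one] at k1
  unfold hE
  rw [key f, k1, key (fun b => f b * Real.log (f b))]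

lemma entOf_eq_hE {A : Type*} [Fintype A] (w f : A → ℝ) (hw : ∑ a, w a = 1) :
    entOf w f = hE w f := by
  simp [entOf, hE, hw]

lemma margin_ent {W : Type*} [Fintype W] [DecidableEq W] (ν : Conf W → ℝ) (h0 : ∀ σ, 0 ≤ ν σ)
    (L : Finset W) (χ : Conf W) (f : Conf W → ℝ) :
    margin ν L χ * entOf (condDist ν L χ) f =
      hE (fun σ => if ∀ v ∈ L, σ v = χ v then ν σ else 0) f := by
  have e : condDist ν L χ =
      fun σ => (margin ν L χ)⁻¹ * (if ∀ v ∈ L, σ v = χ v then ν σ else 0) := by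
    funext σ
    unfold condDist
    split_ifs
    · rw [div_eq_inv_mul]
    · simp
  by_cases hm : margin ν L χ = 0
  · have : ∀ σ, (if ∀ v ∈ L, σ v = χ v then ν σ else 0) = 0 := by
      intro σ
      unfold margin at hm
      rw [Finset.sum_eq_zero_iff_of_nonneg] at hm
      · exact hm σ (Finset.mem_univ _)
      · intro σ _
        split_ifs
        · exact h0 σ
        · exact le_rfl
    simp only [this, hE_zero, hm, zero_mul]
  · rw [e, entOf_eq_hE, hE_smul, ← mul_assoc, mul_inv_cancel₀ hm, one_mul]
    rw [← Finset.mul_sum]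
    exact inv_mul_cancel₀ hm

/-- The configuration with a single plus. -/
def eone {k : ℕ} (i : Fin k) : Fin k → Bool := fun j => decide (j = i)

lemma eone_inj {k : ℕ} : Function.Injective (eone (k := k)) := by
  intro i j h
  have := congrFun h i
  simpa [eone] using this

lemma eone_iff {k : ℕ} (t : Fin k → Bool) :
    ((Finset.univ.filter (fun i : Fin k => t i = true)).card ≤ 1 ∧ ∃ i, t i = true) ↔
      ∃ i, t = eone i := by
  constructor
  · rintro ⟨h, i, hi⟩
    refine ⟨i, ?_⟩
    funext j
    rw [Finset.card_le_one] at h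
    by_cases hj : t j = true
    · have := h j (by simp [hj]) i (by simp [hi])
      simp [eone, this, hi]
    · have : j ≠ i := by rintro rfl; exact hj hi
      simp [eone, this, hj]
  · rintro ⟨i, rfl⟩
    refine ⟨?_, i, by simp [eone]⟩
    rw [Finset.card_le_one]
    intro a ha b hb
    simp [eone] at ha hb
    rw [ha, hb]

lemma fib_sum {k : ℕ} (P : (Fin k → Bool) → Prop) (b : Bool) :
    (∑ t : Fin k → Bool, if ((Finset.univ.filter (fun i : Fin k => t i = true)).card ≤ 1 ∧
        decide (∃ i, t i = true) = b ∧ P t) then (if b then ((k:ℝ))⁻¹ else 1) else 0) =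
      if b then ((Finset.univ.filter (fun i : Fin k => P (eone i))).card : ℝ) * (k:ℝ)⁻¹
        else if P (fun _ => false) then 1 else 0 := by
  cases b
  · rw [Finset.sum_eq_single (fun _ => false)]
    · simp
    · intro t _ ht
      rw [if_neg]
      rintro ⟨_, h, _⟩
      apply ht
      funext i
      simp at h
      exact h i
    · simp
  · simp only [if_true]
    rw [← Finset.sum_filter, Finset.sum_const, nsmul_eq_mul]
    congr 2
    rw [← Finset.card_image_of_injective _ (eone_inj (k := k))]
    congr 1
    ext t
    have := eone_iff t
    simp only [Finset.mem_filter, Finset.mem_univ, true_and, Finset.mem_image, decide_eq_true_eq]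
    rw [← and_assoc, this]
    constructor
    · rintro ⟨⟨i, rfl⟩, h⟩
      exact ⟨i, h, rfl⟩
    · rintro ⟨i, h, rfl⟩
      exact ⟨⟨i, rfl⟩, h⟩

lemma mass_eq {V : Type*} [Fintype V] [DecidableEq V] (μ : Conf V → ℝ) (k : ℕ)
    (P : V → (Fin k → Bool) → Prop) (σ : Conf V) :
    (∑ τ : Conf (V × Fin k), if kstar τ = σ then
        (if ∀ v, P v (fun i => τ (v, i)) then ktrans μ k τ else 0) else 0) =
      μ σ * ∏ v, (if σ v then
        ((Finset.univ.filter (fun i : Fin k => P v (eone i))).card : ℝ) * (k:ℝ)⁻¹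
        else if P v (fun _ => false) then 1 else 0) := by
  simp only [← fib_sum]
  rw [Finset.prod_univ_sum, Fintype.piFinset_univ, Finset.mul_sum]
  refine Fintype.sum_equiv (Equiv.curry V (Fin k) Bool) _ _ ?_
  intro τ
  rw [Finset.prod_ite_zero]
  have hpow : ∏ v, (if σ v then ((k:ℝ))⁻¹ else 1) = ((k:ℝ)⁻¹) ^ plusCount σ := by
    rw [← Finset.prod_filter, Finset.prod_const]
    rfl
  rw [hpow]
  by_cases h1 : kstar τ = σ
  · rw [if_pos h1]
    unfold ktrans
    rw [h1]
    have h1' : ∀ v, decide (∃ i, τ (v, i) = true) = σ v := fun v => by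
      rw [← h1]; rfl
    by_cases h2 : ∀ v : V, (Finset.univ.filter (fun i : Fin k => τ (v, i) = true)).card ≤ 1
    · by_cases h3 : ∀ v, P v (fun i => τ (v, i))
      · rw [if_pos h3, if_pos h2, if_pos]
        intro v _
        exact ⟨h2 v, h1' v, h3 v⟩
      · rw [if_neg h3, if_neg, mul_zero]
        intro h
        exact h3 fun v => (h v (Finset.mem_univ _)).2.2
    · rw [if_neg h2, ite_self, if_neg, mul_zero]
      intro h
      exact h2 fun v => (h v (Finset.mem_univ _)).1
  · rw [if_neg h1, if_neg, mul_zero]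
    intro h
    apply h1
    funext v
    exact (h v (Finset.mem_univ _)).2.1

/-- The pinned and tilted weight. -/
def wx {V : Type*} [Fintype V] [DecidableEq V] (μ : Conf V → ℝ) (x : V → ℝ) (R : Finset V) :
    Conf V → ℝ :=
  fun σ => μ σ * ∏ v, (if v ∈ R then (if σ v then 1 else 0) else (if σ v then x v else 1))

/-- The limiting functional. -/
def Phi {V : Type*} [Fintype V] [DecidableEq V] (μ f : Conf V → ℝ) (x : V → ℝ) : ℝ :=
  ∑ R : Finset V, (∏ v ∈ R, (1 - x v)) * hE (wx μ x R) f

/-- Number of elements of `S` in the fibre of `v`. -/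
def fibN {V : Type*} [DecidableEq V] {k : ℕ} (S : Finset (V × Fin k)) (v : V) : ℕ :=
  (Finset.univ.filter (fun i : Fin k => (v, i) ∈ S)).card

lemma ktrans_nonneg {V : Type*} [Fintype V] [DecidableEq V] (μ : Conf V → ℝ)
    (h0 : ∀ σ, 0 ≤ μ σ) (k : ℕ) (τ : Conf (V × Fin k)) : 0 ≤ ktrans μ k τ := by
  unfold ktrans
  split_ifs
  · exact mul_nonneg (h0 _) (by positivity)
  · exact le_rfl

lemma push_eq {V : Type*} [Fintype V] [DecidableEq V] (μ : Conf V → ℝ) (k : ℕ)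
    (S : Finset (V × Fin k)) (χ : Conf (V × Fin k)) (hχ : ∀ v ∈ S, χ v = false) (σ : Conf V) :
    (∑ τ : Conf (V × Fin k), if kstar τ = σ then
      (if ∀ w ∈ Finset.univ \ S, τ w = χ w then ktrans μ k τ else 0) else 0) =
    ktrans (fun _ => 1) k χ *
      wx μ (fun v => (fibN S v : ℝ) * (k:ℝ)⁻¹) (plusSet (kstar χ)) σ := by
  by_cases hv : ∀ v : V, (Finset.univ.filter (fun i : Fin k => χ (v, i) = true)).card ≤ 1
  · have h := mass_eq μ k (fun v t => ∀ i, (v, i) ∉ S → t i = χ (v, i)) σ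
    have e : ∀ τ : Conf (V × Fin k), (∀ w ∈ Finset.univ \ S, τ w = χ w) ↔
        ∀ v i, (v, i) ∉ S → τ (v, i) = χ (v, i) := by
      intro τ; simp
    simp only [e]
    refine Eq.trans (Finset.sum_congr rfl fun τ _ => ?_) (h.trans ?_)
    · congr
    have hk : ktrans (fun _ => 1) k χ =
        ∏ v, (if v ∈ plusSet (kstar χ) then ((k:ℝ))⁻¹ else 1) := by
      unfold ktrans
      rw [if_pos hv, one_mul, ← Finset.prod_filter, Finset.prod_const]
      congr 1
      unfold plusCount
      congr 1
      ext v; simp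
    rw [hk, wx, mul_left_comm, ← Finset.prod_mul_distrib]
    congr 1
    refine Finset.prod_congr rfl fun v _ => ?_
    by_cases hR : v ∈ plusSet (kstar χ)
    · have hR' : ∃ i, χ (v, i) = true := by simpa [plusSet, kstar] using hR
      obtain ⟨j, hj⟩ := (eone_iff (fun i => χ (v, i))).1 ⟨hv v, hR'⟩
      have hj' : ∀ i, χ (v, i) = eone j i := fun i => congrFun hj i
      have hjS : (v, j) ∉ S := fun h => by
        have := hχ _ h
        rw [hj'] at this
        simp [eone] at this
      rw [if_pos hR, if_pos hR]
      by_cases hs : σ v = true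
      · rw [if_pos hs, if_pos hs]
        have : ∀ inst : DecidablePred
            (fun i : Fin k => ∀ i', (v, i') ∉ S → eone i i' = χ (v, i')),
            @Finset.filter _ (fun i : Fin k => ∀ i', (v, i') ∉ S → eone i i' = χ (v, i')) inst
              Finset.univ = {j} := by
          intro inst
          ext i
          simp only [Finset.mem_filter, Finset.mem_univ, true_and, Finset.mem_singleton]
          constructor
          · intro h
            have := h j hjS
            rw [hj'] at this
            simp [eone] at this
            exact this.symm
          · rintro rfl i' _
            exact (hj' i').symm
        rw [this]; simp
      · rw [if_neg hs, if_neg hs, if_neg, mul_zero]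
        intro h
        have := h j hjS
        rw [hj'] at this
        simp [eone] at this
    · have hR' : ∀ i, χ (v, i) = false := by simpa [plusSet, kstar] using hR
      rw [if_neg hR, if_neg hR, one_mul]
      by_cases hs : σ v = true
      · rw [if_pos hs, if_pos hs]
        congr 2
        unfold fibN
        congr 1
        ext i
        simp only [Finset.mem_filter, Finset.mem_univ, true_and, hR']
        constructor
        · intro h
          by_contra hi
          have := h i hi
          simp [eone] at this
        · intro h i' hi'
          have : i' ≠ i := by rintro rfl; exact hi' h
          simp [eone, this]
      · rw [if_neg hs, if_neg hs, if_pos]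
        intro i _
        exact (hR' i).symm
  · have hk : ktrans (fun _ => 1) k χ = 0 := by
      unfold ktrans
      rw [if_neg hv]
    rw [hk, zero_mul]
    refine Finset.sum_eq_zero fun τ _ => ?_
    split_ifs with h1 h2
    · unfold ktrans
      rw [if_neg]
      intro h
      apply hv
      intro v
      refine le_trans (Finset.card_le_card ?_) (h v)
      intro i
      simp only [Finset.mem_filter, Finset.mem_univ, true_and]
      intro hi
      rw [h2 (v, i) _]
      · exact hi
      · simp only [Finset.mem_sdiff, Finset.mem_univ, true_and]
        intro hS
        rw [hχ _ hS] at hi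
        simp at hi
    · rfl
    · rfl

lemma avgEnt_eq {V : Type*} [Fintype V] [DecidableEq V] (μ f : Conf V → ℝ)
    (h0 : ∀ σ, 0 ≤ μ σ) (k : ℕ) (hk : 1 ≤ k) (S : Finset (V × Fin k)) :
    avgEnt (ktrans μ k) S (fun τ => f (kstar τ)) =
      Phi μ f (fun v => (fibN S v : ℝ) * (k:ℝ)⁻¹) := by
  have hk0 : (k:ℝ) ≠ 0 := by positivity
  set x : V → ℝ := fun v => (fibN S v : ℝ) * (k:ℝ)⁻¹ with hx
  have hcount : ∀ R : Finset V, ∏ v ∈ R, (1 - x v) =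
      ∑ χ : Conf (V × Fin k), if kstar χ = (fun v => decide (v ∈ R)) then
        (if ∀ v i, (v, i) ∈ S → χ (v, i) = false then ktrans (fun _ => (1:ℝ)) k χ else 0)
        else 0 := by
    intro R
    have h := mass_eq (fun _ => (1:ℝ)) k (fun v t => ∀ i, (v, i) ∈ S → t i = false)
      (fun v => decide (v ∈ R))
    refine Eq.trans ?_ (h.symm.trans (Finset.sum_congr rfl fun τ _ => ?_))
    swap
    · congr
    rw [one_mul]
    rw [← Finset.prod_subset (Finset.subset_univ R)]
    · refine Finset.prod_congr rfl fun v hv => ?_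
      simp only [hv, decide_true, if_true]
      have : ∀ inst : DecidablePred (fun i : Fin k => ∀ i', (v, i') ∈ S → eone i i' = false),
          @Finset.filter _ (fun i : Fin k => ∀ i', (v, i') ∈ S → eone i i' = false) inst
          Finset.univ =
          Finset.univ.filter (fun i : Fin k => ¬ (v, i) ∈ S) := by
        intro inst
        ext i
        simp only [Finset.mem_filter, Finset.mem_univ, true_and]
        constructor
        · intro h hi
          have := h i hi
          simp [eone] at this
        · intro h i' hi'
          have : i' ≠ i := by rintro rfl; exact h hi'
          simp [eone, this]
      rw [this]
      have hc := Finset.card_filter_add_card_filter_not (s := (Finset.univ : Finset (Fin k)))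
        (fun i : Fin k => (v, i) ∈ S)
      rw [Finset.card_univ, Fintype.card_fin] at hc
      have hc' : (fibN S v : ℝ) +
        ((Finset.univ.filter (fun i : Fin k => ¬ (v, i) ∈ S)).card : ℝ) = k := by
        have hc2 : fibN S v + (Finset.univ.filter (fun i : Fin k => ¬ (v, i) ∈ S)).card = k := by
          unfold fibN
          convert hc
        exact_mod_cast hc2
      have : ((Finset.univ.filter (fun i : Fin k => ¬ (v, i) ∈ S)).card : ℝ) =
        k - fibN S v := by linarith
      rw [this, hx]
      field_simp
    · intro v _ hv
      simp [hv]
  unfold avgEnt Phi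
  simp only [hcount, Finset.sum_mul]
  rw [Finset.sum_comm]
  refine Finset.sum_congr rfl fun χ _ => ?_
  rw [Finset.sum_eq_single (plusSet (kstar χ))]
  · have hst : kstar χ = (fun v => decide (v ∈ plusSet (kstar χ))) := by
      funext v; simp [plusSet]
    rw [if_pos hst]
    have e : (∀ v ∈ S, χ v = false) ↔ ∀ v i, (v, i) ∈ S → χ (v, i) = false := by simp
    by_cases hχ : ∀ v ∈ S, χ v = false
    · rw [if_pos hχ, if_pos (e.1 hχ), margin_ent _ (ktrans_nonneg μ h0 k), hE_push, ← hE_smul]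
      congr 1
      funext σ
      exact push_eq μ k S χ hχ σ
    · rw [if_neg hχ, if_neg (fun h => hχ (e.2 h)), zero_mul]
  · intro R _ hR
    rw [if_neg, zero_mul]
    intro h
    apply hR
    ext v
    simp [plusSet, h]
  · simp

lemma ent_ktrans {V : Type*} [Fintype V] [DecidableEq V] (μ f : Conf V → ℝ)
    (hμ : IsDist μ) (k : ℕ) (hk : 1 ≤ k) :
    entOf (ktrans μ k) (fun τ => f (kstar τ)) = entOf μ f := by
  have hk0 : (k:ℝ) ≠ 0 := by positivity
  have hp : (fun σ => ∑ τ : Conf (V × Fin k), if kstar τ = σ then ktrans μ k τ else 0) = μ := by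
    funext σ
    have := mass_eq μ k (fun _ _ => True) σ
    simpa [hk0] using this
  have hs : ∑ τ, ktrans μ k τ = 1 := by
    rw [← hμ.2]
    conv_rhs => rw [← hp]
    rw [Finset.sum_comm]
    simp
  rw [entOf_eq_hE _ _ hs, entOf_eq_hE _ _ hμ.2, hE_push, hp]

lemma cnt1 {W : Type*} [Fintype W] [DecidableEq W] (l : ℕ) (w : W) :
    (((Finset.powersetCard l (Finset.univ : Finset W)).filter (fun S => w ∈ S)).card : ℝ) *
      (Fintype.card W : ℝ) = l * ((Fintype.card W).choose l : ℝ) := by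
  rcases l with _ | l
  · simp
  · have h := Finset.card_filter_powersetCard_subset {w} (Finset.univ : Finset W) (l+1)
      (Finset.subset_univ _) (by simp)
    simp only [Finset.singleton_subset_iff, Finset.card_univ, Finset.card_singleton,
      Nat.add_sub_cancel] at h
    rw [h]
    have hm : 1 ≤ Fintype.card W := Fintype.card_pos_iff.2 ⟨w⟩
    obtain ⟨m, hm'⟩ := Nat.exists_eq_add_of_le' hm
    rw [hm', Nat.add_sub_cancel]
    have := Nat.add_one_mul_choose_eq m l
    have h2 : m.choose l * (m+1) = (l+1) * (m+1).choose (l+1) := by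
      rw [mul_comm, this, mul_comm]
    exact_mod_cast h2

lemma cnt2 {W : Type*} [Fintype W] [DecidableEq W] (l : ℕ) (hl : l ≤ Fintype.card W)
    (w w' : W) (hw : w ≠ w') :
    (((Finset.powersetCard l (Finset.univ : Finset W)).filter
      (fun S => w ∈ S ∧ w' ∈ S)).card : ℝ) ≤
      ((l:ℝ) / Fintype.card W) ^ 2 * ((Fintype.card W).choose l : ℝ) := by
  by_cases hl2 : l < 2
  · rw [Finset.card_eq_zero.2]
    · simp only [Nat.cast_zero]; positivity
    · rw [Finset.filter_eq_empty_iff]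
      rintro S hS ⟨h1, h2⟩
      rw [Finset.mem_powersetCard] at hS
      have : ({w, w'} : Finset W) ⊆ S := by
        intro z; simp; rintro (rfl | rfl) <;> assumption
      have := Finset.card_le_card this
      rw [Finset.card_pair hw] at this
      omega
  · have h := Finset.card_filter_powersetCard_subset {w, w'} (Finset.univ : Finset W) l
      (Finset.subset_univ _) (by rw [Finset.card_pair hw]; omega)
    simp only [Finset.insert_subset_iff, Finset.singleton_subset_iff, Finset.card_univ,
      Finset.card_pair hw] at h
    rw [h]
    obtain ⟨j, rfl⟩ := Nat.exists_eq_add_of_le' (not_lt.1 hl2)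
    obtain ⟨m, hm'⟩ := Nat.exists_eq_add_of_le' ((not_lt.1 hl2).trans hl)
    rw [hm'] at hl ⊢
    rw [Nat.add_sub_cancel, Nat.add_sub_cancel]
    have e1 := Nat.add_one_mul_choose_eq m j
    have e2 := Nat.add_one_mul_choose_eq (m+1) (j+1)
    have e1' : ((m:ℝ)+1) * m.choose j = (m+1).choose (j+1) * (j+1) := by exact_mod_cast e1
    have e2' : ((m:ℝ)+1+1) * (m+1).choose (j+1) = (m+2).choose (j+2) * (j+1+1) := by
      exact_mod_cast e2
    have hjm : (j:ℝ) ≤ m := by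
      have : j ≤ m := by omega
      exact_mod_cast this
    push_cast
    have hm0 : (0:ℝ) ≤ m := Nat.cast_nonneg _
    have hj0 : (0:ℝ) ≤ j := Nat.cast_nonneg _
    have e3 : (m.choose j : ℝ) = (j+1)*(j+2)/((m+1)*(m+2)) * (m+2).choose (j+2) := by
      have : ((m+1).choose (j+1) : ℝ) = (m+2).choose (j+2) * (j+1+1) / (m+1+1) := by
        field_simp
        linarith
      rw [this] at e1'
      field_simp at e1' ⊢
      have hz : (m:ℝ) + 1 + 1 = m + 2 := by ring
      have hz' : (j:ℝ) + 1 + 1 = j + 2 := by ring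
      rw [hz, hz'] at e1'
      linarith
    rw [e3]
    refine mul_le_mul_of_nonneg_right ?_ (by positivity)
    rw [div_pow, div_le_div_iff₀ (by positivity) (by positivity)]
    have : 0 ≤ ((j:ℝ)+2) * (m+2) * (m - j) := by
      have : 0 ≤ (m:ℝ) - j := by linarith
      positivity
    nlinarith [this]

lemma moment {V : Type*} [Fintype V] [DecidableEq V] (k : ℕ) (hk : 1 ≤ k) (l : ℕ)
    (hl : l ≤ Fintype.card (V × Fin k)) (v : V) (θ : ℝ) :
    ∑ S ∈ Finset.powersetCard l (Finset.univ : Finset (V × Fin k)),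
      ((fibN S v : ℝ) * (k:ℝ)⁻¹ - θ) ^ 2 ≤
    ((Fintype.card (V × Fin k)).choose l : ℝ) *
      (((l:ℝ) / Fintype.card (V × Fin k) - θ) ^ 2 + ((l:ℝ) / Fintype.card (V × Fin k)) / k) := by
  have hk0 : (0:ℝ) < k := by positivity
  have hm : 0 < Fintype.card (V × Fin k) := Fintype.card_pos_iff.2 ⟨(v, ⟨0, hk⟩)⟩
  have hm0 : (0:ℝ) < Fintype.card (V × Fin k) := by exact_mod_cast hm
  set m := Fintype.card (V × Fin k) with hmdef
  set N : ℝ := (m.choose l : ℝ) with hN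
  set p : ℝ := (l:ℝ) / m with hp
  set T := Finset.powersetCard l (Finset.univ : Finset (V × Fin k)) with hT
  have hN0 : 0 ≤ N := by positivity
  have hp0 : 0 ≤ p := by positivity
  have hfib : ∀ S : Finset (V × Fin k), (fibN S v : ℝ) =
      ∑ i : Fin k, if (v, i) ∈ S then (1:ℝ) else 0 := by
    intro S
    simp [fibN]
  have hc1 : ∀ i : Fin k, ∑ S ∈ T, (if (v, i) ∈ S then (1:ℝ) else 0) = p * N := by
    intro i
    have := cnt1 l (v, i)
    rw [← Finset.sum_filter, Finset.sum_const, nsmul_eq_mul, mul_one, hp, div_mul_eq_mul_div,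
      eq_div_iff hm0.ne']
    exact this
  have s0 : ∑ S ∈ T, (1:ℝ) = N := by
    simp [hT, hN, hmdef]
  have s1 : ∑ S ∈ T, (fibN S v : ℝ) = k * (p * N) := by
    simp only [hfib]
    rw [Finset.sum_comm]
    simp [hc1]
  have s2 : ∑ S ∈ T, (fibN S v : ℝ) ^ 2 ≤ k * (p * N) + k ^ 2 * (p ^ 2 * N) := by
    have : ∀ S ∈ T, (fibN S v : ℝ) ^ 2 =
        ∑ i : Fin k, ∑ j : Fin k, if (v, i) ∈ S ∧ (v, j) ∈ S then (1:ℝ) else 0 := by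
      intro S _
      rw [hfib, sq, Finset.sum_mul_sum]
      refine Finset.sum_congr rfl fun i _ => Finset.sum_congr rfl fun j _ => ?_
      by_cases h1 : (v, i) ∈ S <;> by_cases h2 : (v, j) ∈ S <;> simp [h1, h2]
    rw [Finset.sum_congr rfl this, Finset.sum_comm]
    have hb : ∀ i ∈ (Finset.univ : Finset (Fin k)),
        ∑ S ∈ T, ∑ j : Fin k, (if (v, i) ∈ S ∧ (v, j) ∈ S then (1:ℝ) else 0) ≤
          p * N + k * (p ^ 2 * N) := by
      intro i _
      rw [Finset.sum_comm]
      have hb2 : ∀ j ∈ (Finset.univ : Finset (Fin k)),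
          ∑ S ∈ T, (if (v, i) ∈ S ∧ (v, j) ∈ S then (1:ℝ) else 0) ≤
          (if j = i then p * N else 0) + p ^ 2 * N := by
        intro j _
        by_cases hij : j = i
        · subst hij
          simp only [and_self, if_true]
          rw [hc1]
          have : 0 ≤ p ^ 2 * N := by positivity
          linarith
        · rw [if_neg hij, zero_add]
          have := cnt2 l hl (v, i) (v, j) (by simp; exact fun h => hij h.symm)
          rw [← Finset.sum_filter, Finset.sum_const, nsmul_eq_mul, mul_one]
          exact this
      refine (Finset.sum_le_sum hb2).trans ?_
      rw [Finset.sum_add_distrib]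
      simp
    refine (Finset.sum_le_sum hb).trans ?_
    rw [Finset.sum_const, Finset.card_univ, Fintype.card_fin, nsmul_eq_mul]
    apply le_of_eq; ring
  have ex : ∑ S ∈ T, ((fibN S v : ℝ) * (k:ℝ)⁻¹ - θ) ^ 2 =
      (k:ℝ)⁻¹ ^ 2 * (∑ S ∈ T, (fibN S v : ℝ) ^ 2) - 2 * θ * (k:ℝ)⁻¹ * (∑ S ∈ T, (fibN S v : ℝ))
        + θ ^ 2 * ∑ S ∈ T, (1:ℝ) := by
    rw [Finset.mul_sum, Finset.mul_sum, Finset.mul_sum, ← Finset.sum_sub_distrib,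
      ← Finset.sum_add_distrib]
    refine Finset.sum_congr rfl fun S _ => ?_
    ring
  rw [ex, s1, s0]
  have := mul_le_mul_of_nonneg_left s2 (by positivity : 0 ≤ (k:ℝ)⁻¹ ^ 2)
  refine (add_le_add_left (sub_le_sub_right this _) _).trans (le_of_eq ?_)
  field_simp
  ring

lemma wx_le {V : Type*} [Fintype V] [DecidableEq V] (μ : Conf V → ℝ) (h0 : ∀ σ, 0 ≤ μ σ)
    (x : V → ℝ) (hx : ∀ v, 0 ≤ x v ∧ x v ≤ 1) (R : Finset V) (σ : Conf V) :
    0 ≤ wx μ x R σ ∧ wx μ x R σ ≤ μ σ := by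
  have hp : ∀ v, 0 ≤ (if v ∈ R then (if σ v then (1:ℝ) else 0) else (if σ v then x v else 1)) ∧
      (if v ∈ R then (if σ v then (1:ℝ) else 0) else (if σ v then x v else 1)) ≤ 1 := by
    intro v
    have := hx v
    split_ifs <;> constructor <;> linarith [this.1, this.2]
  constructor
  · exact mul_nonneg (h0 σ) (Finset.prod_nonneg fun v _ => (hp v).1)
  · exact mul_le_of_le_one_right (h0 σ) (Finset.prod_le_one (fun v _ => (hp v).1)
      fun v _ => (hp v).2)

lemma hE_alt {A : Type*} [Fintype A] (w f : A → ℝ) :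
    hE w f = (∑ a, w a * (f a * Real.log (f a))) -
      (∑ a, w a) * (((∑ a, w a * f a) / ∑ a, w a) *
        Real.log ((∑ a, w a * f a) / ∑ a, w a)) := by
  unfold hE
  by_cases h : ∑ a, w a = 0
  · simp [h]
  · rw [← mul_assoc, mul_div_cancel₀ _ h]

lemma mul_log_ge {y : ℝ} (hy : 0 ≤ y) : -1 ≤ y * Real.log y := by
  rcases hy.eq_or_lt with rfl | h
  · simp
  · have := Real.one_sub_inv_le_log_of_pos h
    have := mul_le_mul_of_nonneg_left this hy
    rw [mul_sub, mul_inv_cancel₀ h.ne'] at this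
    linarith

lemma hE_le {V : Type*} [Fintype V] [DecidableEq V] (μ f : Conf V → ℝ) (hμ : IsDist μ)
    (hf : ∀ σ, 0 ≤ f σ) (x : V → ℝ) (hx : ∀ v, 0 ≤ x v ∧ x v ≤ 1) (R : Finset V) :
    hE (wx μ x R) f ≤ (∑ a, μ a * |f a * Real.log (f a)|) + 1 := by
  have hw := wx_le μ hμ.1 x hx R
  rw [hE_alt]
  have h1 : (∑ a, wx μ x R a * (f a * Real.log (f a))) ≤ ∑ a, μ a * |f a * Real.log (f a)| := by
    refine Finset.sum_le_sum fun a _ => ?_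
    calc _ ≤ wx μ x R a * |f a * Real.log (f a)| :=
          mul_le_mul_of_nonneg_left (le_abs_self _) (hw a).1
      _ ≤ _ := mul_le_mul_of_nonneg_right (hw a).2 (abs_nonneg _)
  have hB0 : 0 ≤ ∑ a, wx μ x R a := Finset.sum_nonneg fun a _ => (hw a).1
  have hB1 : ∑ a, wx μ x R a ≤ 1 := by
    rw [← hμ.2]; exact Finset.sum_le_sum fun a _ => (hw a).2
  have hA0 : 0 ≤ ∑ a, wx μ x R a * f a :=
    Finset.sum_nonneg fun a _ => mul_nonneg (hw a).1 (hf a)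
  have h2 := mul_le_mul_of_nonneg_left (mul_log_ge (div_nonneg hA0 hB0)) hB0
  linarith

lemma Phi_le {V : Type*} [Fintype V] [DecidableEq V] (μ f : Conf V → ℝ) (hμ : IsDist μ)
    (hf : ∀ σ, 0 ≤ f σ) : ∃ M : ℝ, ∀ x : V → ℝ, (∀ v, 0 ≤ x v ∧ x v ≤ 1) → Phi μ f x ≤ M := by
  refine ⟨∑ R : Finset V, ((∑ a, μ a * |f a * Real.log (f a)|) + 1), fun x hx => ?_⟩
  refine Finset.sum_le_sum fun R _ => ?_
  have hM : 0 ≤ (∑ a, μ a * |f a * Real.log (f a)|) + 1 :=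
    add_nonneg (Finset.sum_nonneg fun a _ => mul_nonneg (hμ.1 a) (abs_nonneg _)) zero_le_one
  have hp0 : 0 ≤ ∏ v ∈ R, (1 - x v) := Finset.prod_nonneg fun v _ => by linarith [(hx v).2]
  have hp1 : ∏ v ∈ R, (1 - x v) ≤ 1 :=
    Finset.prod_le_one (fun v _ => by linarith [(hx v).2]) fun v _ => by linarith [(hx v).1]
  exact (mul_le_mul_of_nonneg_left (hE_le μ f hμ hf x hx R) hp0).trans
    (mul_le_of_le_one_left hM hp1)

lemma wx_cont {V : Type*} [Fintype V] [DecidableEq V] (μ : Conf V → ℝ) (R : Finset V)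
    (σ : Conf V) : Continuous (fun x : V → ℝ => wx μ x R σ) := by
  unfold wx
  refine continuous_const.mul (continuous_finsetProd _ fun v _ => ?_)
  split_ifs <;> fun_prop

lemma Phi_cont {V : Type*} [Fintype V] [DecidableEq V] (μ f : Conf V → ℝ)
    (h0 : ∀ σ, 0 ≤ μ σ) (θ : ℝ) (hθ : 0 < θ) (hθ1 : θ < 1) :
    ContinuousAt (Phi μ f) (fun _ => θ) := by
  unfold Phi
  refine tendsto_finsetSum _ fun R _ => ?_
  have hA : ContinuousAt (fun x : V → ℝ => ∏ v ∈ R, (1 - x v)) (fun _ => θ) :=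
    Continuous.continuousAt (continuous_finsetProd _ fun v _ => by fun_prop)
  refine ContinuousAt.mul hA ?_
  by_cases hB : ∑ σ, wx μ (fun _ => θ) R σ = 0
  · have hz : ∀ x : V → ℝ, wx μ x R = fun _ => 0 := by
      intro x
      funext σ
      rw [Finset.sum_eq_zero_iff_of_nonneg
        (fun σ _ => (wx_le μ h0 (fun _ => θ) (fun _ => ⟨hθ.le, hθ1.le⟩) R σ).1)] at hB
      have := hB σ (Finset.mem_univ _)
      unfold wx at this ⊢
      rcases mul_eq_zero.1 this with h | h
      · rw [h, zero_mul]
      · rw [Finset.prod_eq_zero_iff] at h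
        obtain ⟨v, _, hv⟩ := h
        refine mul_eq_zero_of_right _ (Finset.prod_eq_zero (Finset.mem_univ v) ?_)
        split_ifs at hv ⊢ <;> simp_all
    simp only [hz]
    exact continuousAt_const
  · simp only [hE_alt]
    have cB : Continuous (fun x : V → ℝ => ∑ σ, wx μ x R σ) :=
      continuous_finsetSum _ fun σ _ => wx_cont μ R σ
    have cA : ∀ φ : Conf V → ℝ, Continuous (fun x : V → ℝ => ∑ σ, wx μ x R σ * φ σ) := fun φ =>
      continuous_finsetSum _ fun σ _ => (wx_cont μ R σ).mul continuous_const
    refine ContinuousAt.sub (cA _).continuousAt (cB.continuousAt.mul ?_)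
    have hd : ContinuousAt (fun x : V → ℝ => (∑ σ, wx μ x R σ * f σ) / ∑ σ, wx μ x R σ)
      (fun _ => θ) := (cA f).continuousAt.div cB.continuousAt hB
    exact ContinuousAt.comp (f := fun x : V → ℝ => (∑ σ, wx μ x R σ * f σ) / ∑ σ, wx μ x R σ)
      (g := fun y : ℝ => y * Real.log y) Real.continuous_mul_log.continuousAt hd

lemma Phi_quad {V : Type*} [Fintype V] [DecidableEq V] (μ f : Conf V → ℝ) (hμ : IsDist μ)
    (hf : ∀ σ, 0 ≤ f σ) (θ : ℝ) (hθ : 0 < θ) (hθ1 : θ < 1) (ε : ℝ) (hε : 0 < ε) :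
    ∃ K : ℝ, 0 ≤ K ∧ ∀ x : V → ℝ, (∀ v, 0 ≤ x v ∧ x v ≤ 1) →
      Phi μ f x ≤ Phi μ f (fun _ => θ) + ε + K * ∑ v, (x v - θ) ^ 2 := by
  obtain ⟨M, hM⟩ := Phi_le μ f hμ hf
  obtain ⟨δ, hδ, hc⟩ := Metric.continuousAt_iff.1 (Phi_cont μ f hμ.1 θ hθ hθ1) ε hε
  refine ⟨(|M| + |Phi μ f (fun _ => θ)|) / δ ^ 2, by positivity, fun x hx => ?_⟩
  have hs0 : ∀ v ∈ (Finset.univ : Finset V), 0 ≤ (x v - θ) ^ 2 := fun v _ => sq_nonneg _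
  by_cases hd : dist x (fun _ => θ) < δ
  · have h1 := hc hd
    rw [Real.dist_eq] at h1
    have h2 := (abs_lt.1 h1).2
    have : 0 ≤ (|M| + |Phi μ f (fun _ => θ)|) / δ ^ 2 * ∑ v, (x v - θ) ^ 2 :=
      mul_nonneg (by positivity) (Finset.sum_nonneg hs0)
    linarith
  · rw [dist_pi_lt_iff hδ] at hd
    push Not at hd
    obtain ⟨v, hv⟩ := hd
    rw [Real.dist_eq] at hv
    have h1 : δ ^ 2 ≤ ∑ v, (x v - θ) ^ 2 := by
      refine le_trans ?_ (Finset.single_le_sum hs0 (Finset.mem_univ v))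
      rw [← sq_abs (x v - θ)]
      exact pow_le_pow_left₀ hδ.le hv 2
    have h2 : |M| + |Phi μ f (fun _ => θ)| ≤
        (|M| + |Phi μ f (fun _ => θ)|) / δ ^ 2 * ∑ v, (x v - θ) ^ 2 := by
      rw [div_mul_eq_mul_div, le_div_iff₀ (by positivity)]
      exact mul_le_mul_of_nonneg_left h1 (by positivity)
    have h3 := hM x hx
    have h4 := le_abs_self M
    have h5 := neg_abs_le (Phi μ f (fun _ => θ))
    linarith

lemma Phi_final {V : Type*} [Fintype V] [DecidableEq V] (μ f : Conf V → ℝ) (hμ : IsDist μ)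
    (θ : ℝ) (hθ : 0 < θ) :
    Phi μ f (fun _ => θ) = Zmag μ θ / θ ^ (Fintype.card V) *
      ∑ R : Finset V, binWeight θ R * mbfTerm μ θ f R := by
  have hpow : ∀ σ : Conf V, ∏ v : V, (if σ v then θ else 1) = θ ^ plusCount σ := by
    intro σ
    rw [← Finset.prod_filter, Finset.prod_const]
    rfl
  have hZ : 0 < Zmag μ θ := by
    have hnn : ∀ σ ∈ (Finset.univ : Finset (Conf V)), 0 ≤ μ σ * θ ^ plusCount σ :=
      fun σ _ => mul_nonneg (hμ.1 σ) (by positivity)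
    refine lt_of_le_of_ne (Finset.sum_nonneg hnn) fun h => ?_
    have h := (Finset.sum_eq_zero_iff_of_nonneg hnn).1 h.symm
    have : ∑ σ, μ σ = 0 := Finset.sum_eq_zero fun σ hσ => by
      rcases mul_eq_zero.1 (h σ hσ) with h | h
      · exact h
      · exact absurd h (by positivity)
    rw [hμ.2] at this
    exact one_ne_zero this
  have hmag : ∀ σ, magnetizeC μ θ σ = μ σ * θ ^ plusCount σ / Zmag μ θ := by
    intro σ
    unfold magnetizeC magnetize Zmag
    simp only [hpow]
  have hterm : ∀ R : Finset V, mbfTerm μ θ f R =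
      θ ^ R.card / Zmag μ θ * hE (wx μ (fun _ => θ) R) f := by
    intro R
    unfold mbfTerm
    rw [margin_ent, ← hE_smul]
    · congr 1
      funext σ
      by_cases h : ∀ v ∈ R, σ v = true
      · rw [if_pos h, hmag, ← hpow]
        have : ∏ v : V, (if σ v then θ else 1) = θ ^ R.card *
            ∏ v, (if v ∈ R then (if σ v then (1:ℝ) else 0) else (if σ v then θ else 1)) := by
          have e : θ ^ R.card = ∏ v, (if v ∈ R then θ else 1) := by
            rw [← Finset.prod_filter, Finset.prod_const]
            congr 2
            ext v; simp
          rw [e, ← Finset.prod_mul_distrib]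
          refine Finset.prod_congr rfl fun v _ => ?_
          by_cases hv : v ∈ R
          · simp [hv, h v hv]
          · simp [hv]
        rw [this]
        unfold wx
        ring
      · rw [if_neg h]
        push Not at h
        obtain ⟨v, hv, hs⟩ := h
        unfold wx
        rw [Finset.prod_eq_zero (Finset.mem_univ v)]
        · simp
        · simp [hv, hs]
    · intro σ
      rw [hmag]
      exact div_nonneg (mul_nonneg (hμ.1 σ) (by positivity)) hZ.le
  unfold Phi
  rw [Finset.mul_sum]
  refine Finset.sum_congr rfl fun R _ => ?_
  rw [hterm, Finset.prod_const]
  unfold binWeight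
  have hc : R.card ≤ Fintype.card V := Finset.card_le_univ R
  have : θ ^ (Fintype.card V) = θ ^ (Fintype.card V - R.card) * θ ^ R.card := by
    rw [← pow_add, Nat.sub_add_cancel hc]
  rw [this]
  field_simp

/-- If there is `k₀` such that for all `k ≥ k₀` the `k`-transformed
distribution `μ_k` satisfies `⌈θkn⌉`-uniform block factorization of entropy with
parameter `C`, then `μ` satisfies `θ`-magnetized block factorization of entropy
with parameter `C`. -/
theorem ubf_implies_mbf {V : Type*} [Fintype V] [DecidableEq V]
    (μ : Conf V → ℝ) (hμ : IsDist μ) (θ C : ℝ) (hθ : 0 < θ) (hθ1 : θ < 1) (hC : 0 < C)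
    (hubf : ∃ k₀ : ℕ, ∀ k : ℕ, k₀ ≤ k →
      UBF (ktrans μ k) (⌈θ * (k : ℝ) * (Fintype.card V : ℝ)⌉₊) C) :
    MBF μ θ C := by
  intro f hf
  obtain ⟨k₀, hk₀⟩ := hubf
  rw [mul_assoc, ← Phi_final μ f hμ θ hθ]
  refine le_of_forall_pos_le_add fun ε hε => ?_
  have hε2 : 0 < ε / (2 * C) := by positivity
  obtain ⟨K, hK0, hK⟩ := Phi_quad μ f hμ hf θ hθ hθ1 (ε / (2 * C)) hε2
  obtain ⟨k₁, hk₁⟩ := exists_nat_gt (K * Fintype.card V * 2 / (ε / (2 * C)))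
  set k := max (max k₀ k₁) 1 with hkdef
  have hk1 : 1 ≤ k := le_max_right _ _
  have hkk₀ : k₀ ≤ k := (le_max_left _ _).trans (le_max_left _ _)
  have hkk₁ : k₁ ≤ k := (le_max_right _ _).trans (le_max_left _ _)
  have hkpos : (0:ℝ) < k := by exact_mod_cast hk1
  set l := ⌈θ * (k : ℝ) * (Fintype.card V : ℝ)⌉₊ with hldef
  have hU := hk₀ k hkk₀ (fun τ => f (kstar τ)) (fun τ => hf _)
  rw [ent_ktrans μ f hμ k hk1] at hU
  have hm : Fintype.card (V × Fin k) = Fintype.card V * k := by simp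
  have hl : l ≤ Fintype.card (V × Fin k) := by
    rw [hm, hldef, Nat.ceil_le]
    push_cast
    have : (0:ℝ) ≤ k * Fintype.card V := by positivity
    nlinarith
  have hN : (0:ℝ) < (Fintype.card (V × Fin k)).choose l := by
    exact_mod_cast Nat.choose_pos hl
  have hmom : ∀ v : V, ∑ S ∈ Finset.powersetCard l (Finset.univ : Finset (V × Fin k)),
      ((fibN S v : ℝ) * (k:ℝ)⁻¹ - θ) ^ 2 ≤
      ((Fintype.card (V × Fin k)).choose l : ℝ) * (2 / k) := by
    intro v
    refine (moment k hk1 l hl v θ).trans (mul_le_mul_of_nonneg_left ?_ hN.le)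
    have hn : 1 ≤ Fintype.card V := Fintype.card_pos_iff.2 ⟨v⟩
    have hn' : (1:ℝ) ≤ Fintype.card V := by exact_mod_cast hn
    have hmpos : (0:ℝ) < Fintype.card (V × Fin k) := by
      rw [hm]; push_cast; positivity
    have hkm : (k:ℝ) ≤ Fintype.card (V × Fin k) := by
      rw [hm]; push_cast; nlinarith
    have hmR : (Fintype.card (V × Fin k) : ℝ) = Fintype.card V * k := by exact_mod_cast hm
    have hp1 : (l:ℝ) / Fintype.card (V × Fin k) ≤ 1 := by
      rw [div_le_one hmpos]; exact_mod_cast hl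
    have hpl : θ ≤ (l:ℝ) / Fintype.card (V × Fin k) := by
      rw [le_div_iff₀ hmpos, hmR]
      have := Nat.le_ceil (θ * (k : ℝ) * (Fintype.card V : ℝ))
      rw [← hldef] at this
      linarith
    have hpu : (l:ℝ) / Fintype.card (V × Fin k) ≤ θ + 1 / k := by
      have h1 : (l:ℝ) < θ * (k : ℝ) * (Fintype.card V : ℝ) + 1 :=
        Nat.ceil_lt_add_one (by positivity)
      have h2 : (l:ℝ) / Fintype.card (V × Fin k) ≤ θ + 1 / Fintype.card (V × Fin k) := by
        rw [div_le_iff₀ hmpos, add_mul, one_div, inv_mul_cancel₀ hmpos.ne', hmR]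
        linarith
      have h3 : 1 / (Fintype.card (V × Fin k) : ℝ) ≤ 1 / k :=
        one_div_le_one_div_of_le hkpos hkm
      linarith
    have hk1' : (1:ℝ) / k ≤ 1 := by
      rw [div_le_one hkpos]; exact_mod_cast hk1
    set p := (l:ℝ) / Fintype.card (V × Fin k)
    have a1 : (p - θ) ^ 2 ≤ 1 / k := by
      have : 0 ≤ p - θ := by linarith
      have : p - θ ≤ 1 / k := by linarith
      nlinarith
    have a2 : p / k ≤ 1 / k := div_le_div_of_nonneg_right hp1 hkpos.le
    have a3 : (2:ℝ) / k = 1 / k + 1 / k := by ring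
    linarith
  have hsum : ∑ S ∈ Finset.powersetCard l (Finset.univ : Finset (V × Fin k)),
      avgEnt (ktrans μ k) S (fun τ => f (kstar τ)) ≤
      ((Fintype.card (V × Fin k)).choose l : ℝ) *
        (Phi μ f (fun _ => θ) + ε / (2 * C) + K * (Fintype.card V * (2 / k))) := by
    have hb : ∀ S ∈ Finset.powersetCard l (Finset.univ : Finset (V × Fin k)),
        avgEnt (ktrans μ k) S (fun τ => f (kstar τ)) ≤
        Phi μ f (fun _ => θ) + ε / (2 * C) +
          K * ∑ v, ((fibN S v : ℝ) * (k:ℝ)⁻¹ - θ) ^ 2 := by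
      intro S _
      rw [avgEnt_eq μ f hμ.1 k hk1 S]
      refine hK _ fun v => ⟨by positivity, ?_⟩
      have : fibN S v ≤ k := by
        exact (Finset.card_filter_le _ _).trans (by simp)
      rw [← div_eq_mul_inv, div_le_one hkpos]
      exact_mod_cast this
    refine (Finset.sum_le_sum hb).trans ?_
    rw [Finset.sum_add_distrib, Finset.sum_const, ← Finset.mul_sum, Finset.sum_comm,
      Finset.card_powersetCard, Finset.card_univ, nsmul_eq_mul]
    have h1 := Finset.sum_le_sum (fun v (_ : v ∈ (Finset.univ : Finset V)) => hmom v)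
    rw [Finset.sum_const, Finset.card_univ, nsmul_eq_mul] at h1
    have h2 := mul_le_mul_of_nonneg_left h1 hK0
    refine (add_le_add_right h2 _).trans (le_of_eq ?_)
    ring
  have hfin : K * (Fintype.card V * (2 / k)) ≤ ε / (2 * C) := by
    have h1 : K * Fintype.card V * 2 / (ε / (2 * C)) ≤ k :=
      hk₁.le.trans (by exact_mod_cast hkk₁)
    rw [div_le_iff₀ hε2] at h1
    have : K * (Fintype.card V * (2 / (k:ℝ))) = K * Fintype.card V * 2 / k := by ring
    rw [this, div_le_iff₀ hkpos]
    linarith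
  have h1 := hU.trans (mul_le_mul_of_nonneg_left hsum (by positivity))
  have h2 : C / ((Fintype.card (V × Fin k)).choose l : ℝ) *
      (((Fintype.card (V × Fin k)).choose l : ℝ) *
        (Phi μ f (fun _ => θ) + ε / (2 * C) + K * (Fintype.card V * (2 / k)))) =
      C * (Phi μ f (fun _ => θ) + ε / (2 * C) + K * (Fintype.card V * (2 / k))) := by
    rw [← mul_assoc, div_mul_cancel₀ _ hN.ne']
  rw [h2] at h1
  have h3 := mul_le_mul_of_nonneg_left hfin hC.le
  have h4 : C * (ε / (2 * C)) = ε / 2 := by field_simp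
  rw [mul_add, mul_add, h4] at h1
  linarith
end
end

section
/- Let μ be a distribution over {-1,+1}^V, k ≥ 2 an integer, and μ_k = Trans(μ, k). Let φ ∈ ℝ_{>0}^{V×[k]} be local fields and π_k = (μ_k)^(φ). Define averaged fields ϕ ∈ ℝ_{>0}^V by ϕ_w = (1/k) Σ_{h∈[k]} φ_{(w,h)} and let π = μ^(ϕ). Then for all (u,i), (v,j) ∈ V×[k]: (1) if u ≠ v, |Ψ^inf_{π_k}((u,i),(v,j))| ≤ (φ_{(v,j)} / Σ_{h∈[k]} φ_{(v,h)}) · |Ψ^inf_π(u,v)|; (2) if u = v and i ≠ j, |Ψ^inf_{π_k}((u,i),(u,j))| ≤ φ_{(u,j)} / Σ_{h∈[k], h≠i} φ_{(u,h)}. -/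
open Classical Finset

noncomputable section

open PaperIsing
namespace KT

def rowT (k : ℕ) (b : Bool) : Finset (Fin k → Bool) :=
  if b then Finset.univ.image (fun h : Fin k => fun h' : Fin k => decide (h' = h))
  else {fun _ => false}

lemma row_sum {k : ℕ} (b : Bool) (q : Fin k → ℝ) :
    ∑ r ∈ rowT k b, ∏ h : Fin k, (if r h then q h else 1) = if b then ∑ h, q h else 1 := by
  cases b
  · simp [rowT]
  · simp only [rowT, if_true]
    rw [Finset.sum_image]
    · simp
    · intro a _ b _ hab
      have := congrFun hab a
      simpa using this

lemma mem_rowT {k : ℕ} (b : Bool) (r : Fin k → Bool) :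
    r ∈ rowT k b ↔ ((Finset.univ.filter (fun i : Fin k => r i = true)).card ≤ 1 ∧
      decide (∃ i, r i = true) = b) := by
  cases b
  · simp only [rowT, Bool.false_eq_true, if_false, Finset.mem_singleton]
    constructor
    · rintro rfl
      simp
    · rintro ⟨_, h⟩
      funext i
      simp at h
      exact h i
  · simp only [rowT, if_true, Finset.mem_image, Finset.mem_univ, true_and, decide_eq_true_eq]
    constructor
    · rintro ⟨h, rfl⟩
      simp [Finset.filter_eq']
    · rintro ⟨hc, i, hi⟩
      refine ⟨i, ?_⟩
      rw [Finset.card_le_one] at hc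
      funext h'
      by_cases hh : h' = i
      · simp [hh, hi]
      · simp only [hh, decide_false]
        by_contra hne
        apply hh
        apply hc h' _ i _
        · simpa using (Ne.symm hne)
        · simpa using hi

lemma key {V : Type*} [Fintype V] [DecidableEq V] (μ : Conf V → ℝ) (k : ℕ)
    (q : V × Fin k → ℝ) (g : Conf V → ℝ) :
    ∑ τ : Conf (V × Fin k), ktrans μ k τ * (∏ x, if τ x then q x else 1) * g (kstar τ) =
    ∑ σ : Conf V, μ σ * (∏ v, if σ v then (k : ℝ)⁻¹ * ∑ h, q (v, h) else 1) * g σ := by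
  rw [← Finset.sum_fiberwise (s := Finset.univ) (g := fun τ : Conf (V × Fin k) => kstar τ)]
  refine Finset.sum_congr rfl fun σ _ => ?_
  have h1 : ∏ v, (if σ v then (k : ℝ)⁻¹ * ∑ h, q (v, h) else 1) =
      ((k : ℝ)⁻¹) ^ plusCount σ * ∏ v, (if σ v then ∑ h, q (v, h) else 1) := by
    have : ((k : ℝ)⁻¹) ^ plusCount σ = ∏ v, (if σ v then (k : ℝ)⁻¹ else 1) := by
      rw [Finset.prod_ite]
      simp [plusCount, plusSet]
    rw [this, ← Finset.prod_mul_distrib]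
    refine Finset.prod_congr rfl fun v _ => ?_
    split_ifs <;> simp
  have h2 : ∏ v, (if σ v then ∑ h, q (v, h) else 1) =
      ∑ ρ ∈ Fintype.piFinset (fun v => rowT k (σ v)), ∏ v, ∏ h, (if ρ v h then q (v, h) else 1) := by
    have h5 := Finset.prod_univ_sum (fun v => rowT k (σ v))
      (fun v (r : Fin k → Bool) => ∏ h, (if r h then q (v, h) else 1))
    rw [← h5]
    exact Finset.prod_congr rfl fun v _ => (row_sum (σ v) (fun h => q (v, h))).symm
  rw [h1, h2]
  simp only [Finset.mul_sum, Finset.sum_mul]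
  symm
  rw [Finset.sum_filter]
  have h3 : ∀ ρ : V → Fin k → Bool, ρ ∈ Fintype.piFinset (fun v => rowT k (σ v)) ↔
      ((∀ v, (Finset.univ.filter (fun i : Fin k => ρ v i = true)).card ≤ 1) ∧
        kstar (fun x : V × Fin k => ρ x.1 x.2) = σ) := by
    intro ρ
    rw [Fintype.mem_piFinset]
    simp only [mem_rowT, forall_and]
    refine and_congr Iff.rfl ?_
    rw [funext_iff]
    rfl
  rw [← Equiv.sum_comp (Equiv.curry V (Fin k) Bool).symm]
  rw [← Finset.sum_filter_add_sum_filter_not Finset.univ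
    (fun ρ => ρ ∈ Fintype.piFinset (fun v => rowT k (σ v)))]
  rw [Finset.sum_eq_zero (s := Finset.univ.filter
    (fun ρ => ¬ ρ ∈ Fintype.piFinset (fun v => rowT k (σ v)))), add_zero]
  · rw [Finset.filter_mem_eq_inter, Finset.univ_inter]
    refine Finset.sum_congr rfl fun ρ hρ => ?_
    obtain ⟨ha, hb⟩ := (h3 ρ).1 hρ
    have hb' : kstar ((Equiv.curry V (Fin k) Bool).symm ρ) = σ := hb
    have hkt : ktrans μ k ((Equiv.curry V (Fin k) Bool).symm ρ)
        = μ σ * ((k : ℝ)⁻¹) ^ plusCount σ := by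
      unfold ktrans
      rw [if_pos (by exact ha), hb']
    rw [if_pos hb', hkt, hb', Fintype.prod_prod_type]
    simp only [Equiv.curry_symm_apply, Function.uncurry_apply_pair]
    ring
  · intro ρ hρ
    rw [Finset.mem_filter, h3] at hρ
    split_ifs with hs
    · have : ktrans μ k ((Equiv.curry V (Fin k) Bool).symm ρ) = 0 := by
        unfold ktrans
        rw [if_neg]
        intro hh
        exact hρ.2 ⟨hh, hs⟩
      rw [this]; ring
    · rfl

section
variable {V : Type*} [Fintype V] [DecidableEq V]

/-- unnormalized weight -/
def wt (μ : Conf V → ℝ) (lam : V → ℝ) (σ : Conf V) : ℝ :=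
  μ σ * ∏ v : V, if σ v then lam v else 1

lemma infl_mag (μ : Conf V → ℝ) (lam : V → ℝ) (hZ : 0 < ∑ σ, wt μ lam σ) (u v : V) :
    infl (magnetize μ lam) u v = infl (wt μ lam) u v := by
  have e : ∀ (P : Conf V → Prop) (inst : DecidablePred P),
      (∑ σ, if P σ then magnetize μ lam σ else 0)
      = (∑ σ, if P σ then wt μ lam σ else 0) / ∑ σ, wt μ lam σ := by
    intro P inst
    rw [Finset.sum_div]
    refine Finset.sum_congr rfl fun σ _ => ?_
    split_ifs
    · rfl
    · simp
  unfold infl condPlusProb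
  rw [e, e, e, e]
  rw [div_div_div_cancel_right₀ hZ.ne', div_div_div_cancel_right₀ hZ.ne']
  simp only [div_pos_iff_of_pos_right hZ]

lemma ktrans_atmost (μ : Conf V → ℝ) (k : ℕ) (τ : Conf (V × Fin k)) (hτ : ktrans μ k τ ≠ 0)
    (u : V) (i j : Fin k) (hi : τ (u, i) = true) (hj : τ (u, j) = true) : i = j := by
  unfold ktrans at hτ
  split_ifs at hτ with h
  · have := Finset.card_le_one.1 (h u) i (by simpa using hi) j (by simpa using hj)
    exact this
  · simp at hτ

/-- product of selected field -/
lemma sel_prod (μ : Conf V → ℝ) (k : ℕ) (q : V × Fin k → ℝ) (τ : Conf (V × Fin k))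
    (hτ : ktrans μ k τ ≠ 0) (u : V) (i : Fin k) (hs : kstar τ u = true) :
    (∏ x, if τ x then (if x.1 = u ∧ x.2 ≠ i then 0 else q x) else 1) =
    if τ (u, i) = true then ∏ x, (if τ x then q x else 1) else 0 := by
  split_ifs with h
  · refine Finset.prod_congr rfl fun x _ => ?_
    by_cases hx : τ x = true
    · rw [if_pos hx, if_pos hx, if_neg]
      rintro ⟨h1, h2⟩
      obtain ⟨a, b⟩ := x
      simp only at h1 h2
      subst h1
      exact h2 (ktrans_atmost μ k τ hτ a b i hx h)
    · rw [if_neg hx, if_neg hx]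
  · have : ∃ i', τ (u, i') = true := by simpa [kstar] using hs
    obtain ⟨i', hi'⟩ := this
    apply Finset.prod_eq_zero (Finset.mem_univ (u, i'))
    rw [if_pos hi', if_pos]
    refine ⟨rfl, ?_⟩
    rintro rfl
    exact h hi'

lemma kstar_of {k : ℕ} (τ : Conf (V × Fin k)) (u : V) (i : Fin k) (h : τ (u, i) = true) :
    kstar τ u = true := by
  simp only [kstar, decide_eq_true_eq]
  exact ⟨i, h⟩

/-- averaged field -/
def av {k : ℕ} (q : V × Fin k → ℝ) (w : V) : ℝ := (k : ℝ)⁻¹ * ∑ h : Fin k, q (w, h)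

lemma sel_step (μ : Conf V → ℝ) (k : ℕ) (q : V × Fin k → ℝ) (u : V) (i : Fin k)
    (g : Conf (V × Fin k) → ℝ) :
    ∑ τ, (if τ (u, i) = true then wt (ktrans μ k) q τ * g τ else 0) =
    ∑ τ, wt (ktrans μ k) (fun x => if x.1 = u ∧ x.2 ≠ i then 0 else q x) τ *
      ((if kstar τ u = true then 1 else 0) * g τ) := by
  refine Finset.sum_congr rfl fun τ _ => ?_
  unfold wt
  by_cases h0 : ktrans μ k τ = 0
  · simp [h0]
  by_cases hs : kstar τ u = true
  · rw [sel_prod μ k q τ h0 u i hs, if_pos hs]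
    split_ifs <;> ring
  · rw [if_neg hs, if_neg (fun h => hs (kstar_of τ u i h))]
    ring

lemma av_step (μ : Conf V → ℝ) (k : ℕ) (q : V × Fin k → ℝ) (u : V) (i : Fin k)
    (hq : ∑ h, q (u, h) ≠ 0) (σ : Conf V) (hs : σ u = true) :
    wt μ (av (fun x => if x.1 = u ∧ x.2 ≠ i then 0 else q x)) σ =
    (q (u, i) / ∑ h, q (u, h)) * wt μ (av q) σ := by
  unfold wt
  rw [← Finset.mul_prod_erase _ _ (Finset.mem_univ u), ← Finset.mul_prod_erase _ _ (Finset.mem_univ u)]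
  rw [if_pos hs, if_pos hs]
  have : ∀ w ∈ Finset.univ.erase u,
      (if σ w then av (fun x : V × Fin k => if x.1 = u ∧ x.2 ≠ i then 0 else q x) w else 1)
      = if σ w then av q w else 1 := by
    intro w hw
    have hw' := Finset.ne_of_mem_erase hw
    simp [av, hw']
  rw [Finset.prod_congr rfl this]
  have h2 : av (fun x : V × Fin k => if x.1 = u ∧ x.2 ≠ i then 0 else q x) u
      = (k : ℝ)⁻¹ * q (u, i) := by
    unfold av
    congr 1
    rw [Finset.sum_eq_single i]
    · simp
    · intro b _ hb
      simp [hb]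
    · simp
  rw [h2]
  unfold av
  field_simp

lemma key' (μ : Conf V → ℝ) (k : ℕ) (q : V × Fin k → ℝ) (g : Conf V → ℝ) :
    ∑ τ, wt (ktrans μ k) q τ * g (kstar τ) = ∑ σ, wt μ (av q) σ * g σ := key μ k q g

lemma one_sel (μ : Conf V → ℝ) (k : ℕ) (q : V × Fin k → ℝ) (u : V) (i : Fin k)
    (hq : ∑ h, q (u, h) ≠ 0) (g : Conf V → ℝ) :
    ∑ τ, (if τ (u, i) = true then wt (ktrans μ k) q τ * g (kstar τ) else 0) =
    (q (u, i) / ∑ h, q (u, h)) * ∑ σ, (if σ u = true then wt μ (av q) σ * g σ else 0) := by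
  rw [sel_step μ k q u i (fun τ => g (kstar τ)),
    key' μ k _ (fun σ => (if σ u = true then 1 else 0) * g σ), Finset.mul_sum]
  refine Finset.sum_congr rfl fun σ _ => ?_
  split_ifs with h
  · rw [av_step μ k q u i hq σ h]; ring
  · ring

lemma two_sel (μ : Conf V → ℝ) (k : ℕ) (q : V × Fin k → ℝ) (u v : V) (i j : Fin k) (huv : u ≠ v)
    (hq : ∑ h, q (u, h) ≠ 0) (hq' : ∑ h, q (v, h) ≠ 0) :
    ∑ τ, (if τ (u, i) = true ∧ τ (v, j) = true then wt (ktrans μ k) q τ else 0) =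
    (q (u, i) / ∑ h, q (u, h)) * (q (v, j) / ∑ h, q (v, h)) *
      ∑ σ, (if σ u = true ∧ σ v = true then wt μ (av q) σ else 0) := by
  have e := sel_step μ k q u i (fun τ => if τ (v, j) = true then 1 else 0)
  have e0 : ∀ τ : Conf (V × Fin k),
      (if τ (u, i) = true ∧ τ (v, j) = true then wt (ktrans μ k) q τ else 0) =
      (if τ (u, i) = true then wt (ktrans μ k) q τ * (if τ (v, j) = true then 1 else 0) else 0) := by
    intro τ; split_ifs <;> simp_all
  rw [Finset.sum_congr rfl (fun τ _ => e0 τ), e]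
  have e1 := one_sel μ k (fun x => if x.1 = u ∧ x.2 ≠ i then 0 else q x) v j
    (by simpa [huv.symm] using hq') (fun σ => if σ u = true then 1 else 0)
  have e2 : ∀ τ : Conf (V × Fin k),
      wt (ktrans μ k) (fun x => if x.1 = u ∧ x.2 ≠ i then 0 else q x) τ *
      ((if kstar τ u = true then 1 else 0) * (if τ (v, j) = true then 1 else 0)) =
      if τ (v, j) = true then wt (ktrans μ k) (fun x => if x.1 = u ∧ x.2 ≠ i then 0 else q x) τ *
        (if kstar τ u = true then 1 else 0) else 0 := by
    intro τ; split_ifs <;> ring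
  rw [Finset.sum_congr rfl (fun τ _ => e2 τ), e1]
  simp only [huv.symm, false_and, if_false]
  rw [mul_comm (q (u, i) / _), mul_assoc]
  congr 1
  rw [Finset.mul_sum]
  refine Finset.sum_congr rfl fun σ _ => ?_
  by_cases h1 : σ u = true <;> by_cases h2 : σ v = true
  · simp only [h1, h2, and_self, if_true]
    rw [av_step μ k q u i hq σ h1]; ring
  all_goals simp [h1, h2]

lemma sum_false_eq {W : Type*} [Fintype W] [DecidableEq W] (f : Conf W → ℝ) (x : W) :
    ∑ σ, (if σ x = false then f σ else 0) =
      (∑ σ, f σ) - ∑ σ, (if σ x = true then f σ else 0) := by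
  rw [← Finset.sum_sub_distrib]
  refine Finset.sum_congr rfl fun σ _ => ?_
  cases σ x <;> simp

lemma sum_false_eq' {W : Type*} [Fintype W] [DecidableEq W] (f : Conf W → ℝ) (x y : W) :
    ∑ σ, (if σ x = false ∧ σ y = true then f σ else 0) =
      (∑ σ, (if σ y = true then f σ else 0)) -
        ∑ σ, (if σ x = true ∧ σ y = true then f σ else 0) := by
  rw [← Finset.sum_sub_distrib]
  refine Finset.sum_congr rfl fun σ _ => ?_
  cases σ x <;> simp

lemma real1 (A N B C p r : ℝ) (hA : 0 < A) (hN : 0 ≤ N) (hC : 0 ≤ C) (hCN : C ≤ N)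
    (hp : 0 < p) (hp1 : p < 1) (hr : 0 < r) :
    |p * r * B / (p * A) - (r * (B + C) - p * r * B) / (N + A - p * A)| ≤
      r * |if 0 < N then B / A - C / N else 0| := by
  have hpA : p * A < A := by nlinarith
  have hD : 0 < N + A - p * A := by linarith
  split_ifs with h
  · have : p * r * B / (p * A) - (r * (B + C) - p * r * B) / (N + A - p * A) =
        (N / (N + A - p * A)) * (r * (B / A - C / N)) := by
      field_simp
      ring
    rw [this, abs_mul, abs_mul r, abs_of_pos hr, abs_of_pos (div_pos h hD)]
    apply mul_le_of_le_one_left (by positivity)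
    rw [div_le_one hD]; linarith
  · have hN0 : N = 0 := by linarith
    have hC0 : C = 0 := by linarith
    subst hN0 hC0
    have h1 : (1 - p) ≠ 0 := by linarith
    have h2 : 0 + A - p * A = (1 - p) * A := by ring
    have h3 : r * (B + 0) - p * r * B = (1 - p) * (r * B) := by ring
    rw [h2, h3, mul_div_mul_left _ _ h1, mul_assoc, mul_div_mul_left _ _ hp.ne']
    simp

lemma wt_pos_sum (μ : Conf V → ℝ) (hμ : IsDist μ) (lam : V → ℝ) (hl : ∀ v, 0 < lam v) :
    (∀ σ, 0 ≤ wt μ lam σ) ∧ 0 < ∑ σ, wt μ lam σ := by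
  have hp : ∀ σ : Conf V, 0 < ∏ v : V, (if σ v then lam v else 1) := by
    intro σ
    refine Finset.prod_pos fun v _ => ?_
    split_ifs
    · exact hl v
    · exact one_pos
  have h0 : ∀ σ, 0 ≤ wt μ lam σ := fun σ => mul_nonneg (hμ.1 σ) (hp σ).le
  refine ⟨h0, ?_⟩
  have : ∃ σ, 0 < μ σ := by
    by_contra hcon
    push Not at hcon
    have := Finset.sum_nonpos (s := Finset.univ) (fun σ _ => hcon σ)
    rw [hμ.2] at this
    linarith
  obtain ⟨σ, hσ⟩ := this
  exact Finset.sum_pos' (fun σ _ => h0 σ) ⟨σ, Finset.mem_univ σ, mul_pos hσ (hp σ)⟩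

end

end KT

open KT

/-- Influence bounds for the magnetized `k`-transformed distribution
`π_k = (μ_k)^(φ)` in terms of `π = μ^(ϕ)` with averaged fields
`ϕ_w = (1/k) Σ_h φ_{(w,h)}`. -/
theorem ktrans_influence_bounds {V : Type*} [Fintype V] [DecidableEq V]
    (μ : Conf V → ℝ) (hμ : IsDist μ) (k : ℕ) (hk : 2 ≤ k)
    (φ : V × Fin k → ℝ) (hφ : ∀ x, 0 < φ x) :
    (∀ (u v : V) (i j : Fin k), u ≠ v →
        |infl (magnetize (ktrans μ k) φ) (u, i) (v, j)| ≤
          (φ (v, j) / ∑ h : Fin k, φ (v, h)) *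
            |infl (magnetize μ (fun w => (k : ℝ)⁻¹ * ∑ h : Fin k, φ (w, h))) u v|) ∧
    (∀ (u : V) (i j : Fin k), i ≠ j →
        |infl (magnetize (ktrans μ k) φ) (u, i) (u, j)| ≤
          φ (u, j) / ∑ h ∈ Finset.univ.erase i, φ (u, h)) := by
  have hav : ∀ w, 0 < av φ w := by
    intro w
    unfold av
    have : 0 < ∑ h : Fin k, φ (w, h) :=
      Finset.sum_pos (fun h _ => hφ _) ⟨⟨0, by omega⟩, Finset.mem_univ _⟩
    have : (0:ℝ) < k := by exact_mod_cast (by omega : 0 < k)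
    positivity
  have hS : ∀ w, 0 < ∑ h : Fin k, φ (w, h) := fun w =>
      Finset.sum_pos (fun h _ => hφ _) ⟨⟨0, by omega⟩, Finset.mem_univ _⟩
  have hE : ∀ (w : V) (i : Fin k), 0 < ∑ h ∈ Finset.univ.erase i, φ (w, h) := by
    intro w i
    refine Finset.sum_pos (fun h _ => hφ _) ?_
    rw [← Finset.card_pos, Finset.card_erase_of_mem (Finset.mem_univ _), Finset.card_univ,
      Fintype.card_fin]
    omega
  have hSE : ∀ (w : V) (i : Fin k),
      ∑ h : Fin k, φ (w, h) = φ (w, i) + ∑ h ∈ Finset.univ.erase i, φ (w, h) := fun w i =>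
    (Finset.add_sum_erase _ (fun h => φ (w, h)) (Finset.mem_univ i)).symm
  have hp0 : ∀ (w : V) (i : Fin k), 0 < φ (w, i) / ∑ h : Fin k, φ (w, h) := fun w i =>
    div_pos (hφ _) (hS w)
  have hp1 : ∀ (w : V) (i : Fin k), φ (w, i) / ∑ h : Fin k, φ (w, h) < 1 := by
    intro w i
    rw [div_lt_one (hS w), hSE w i]
    linarith [hE w i]
  obtain ⟨hw0, hZ⟩ := wt_pos_sum μ hμ (av φ) hav
  have hZk : ∑ τ, wt (ktrans μ k) φ τ = ∑ σ, wt μ (av φ) σ := by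
    have := key' μ k φ (fun _ => 1)
    simpa using this
  have hone : ∀ (u : V) (i : Fin k),
      ∑ τ, (if τ (u, i) = true then wt (ktrans μ k) φ τ else 0) =
      (φ (u, i) / ∑ h, φ (u, h)) * ∑ σ, (if σ u = true then wt μ (av φ) σ else 0) := by
    intro u i
    have := one_sel μ k φ u i (hS u).ne' (fun _ => 1)
    simpa using this
  have hnn : ∀ (P : Conf V → Prop) (inst : DecidablePred P),
      0 ≤ ∑ σ, (if P σ then wt μ (av φ) σ else 0) := by
    intro P inst
    refine Finset.sum_nonneg fun σ _ => ?_
    split_ifs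
    · exact hw0 σ
    · exact le_rfl
  have hsplit : ∀ u : V, ∑ σ, wt μ (av φ) σ =
      (∑ σ, if σ u = false then wt μ (av φ) σ else 0) +
        ∑ σ, if σ u = true then wt μ (av φ) σ else 0 := by
    intro u
    rw [sum_false_eq]; ring
  refine ⟨?_, ?_⟩
  · intro u v i j huv
    change |infl (magnetize (ktrans μ k) φ) (u, i) (v, j)| ≤
          (φ (v, j) / ∑ h : Fin k, φ (v, h)) * |infl (magnetize μ (av φ)) u v|
    rw [infl_mag _ _ (by rw [hZk]; exact hZ), infl_mag _ _ hZ]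
    conv_lhs => unfold infl
    split_ifs with h
    swap
    · rw [abs_zero]
      exact mul_nonneg (hp0 v j).le (abs_nonneg _)
    obtain ⟨-, h1, h2⟩ := h
    unfold condPlusProb
    rw [sum_false_eq', sum_false_eq, two_sel μ k φ u v i j huv (hS u).ne' (hS v).ne',
      hone, hone, hZk]
    rw [hone] at h1
    have hA := (pos_iff_pos_of_mul_pos h1).1 (hp0 u i)
    have hBC : ∑ σ, (if σ v = true then wt μ (av φ) σ else 0) =
        (∑ σ, if σ u = true ∧ σ v = true then wt μ (av φ) σ else 0) +
        (∑ σ, if σ u = false ∧ σ v = true then wt μ (av φ) σ else 0) := by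
      rw [sum_false_eq']; ring
    have hCN : (∑ σ, if σ u = false ∧ σ v = true then wt μ (av φ) σ else 0) ≤
        ∑ σ, if σ u = false then wt μ (av φ) σ else 0 := by
      refine Finset.sum_le_sum fun σ _ => ?_
      have := hw0 σ
      split_ifs <;> simp_all
    have := real1 _ _ (∑ σ, if σ u = true ∧ σ v = true then wt μ (av φ) σ else 0) _ _ _
      hA (hnn _ _) (hnn _ _) hCN (hp0 u i) (hp1 u i) (hp0 v j)
    rw [hBC, hsplit u]
    refine this.trans (le_of_eq ?_)
    unfold infl condPlusProb
    simp only [huv, ne_eq, not_false_eq_true, hA, true_and]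
  · intro u i j hij
    rw [infl_mag _ _ (by rw [hZk]; exact hZ)]
    unfold infl
    split_ifs with h
    swap
    · rw [abs_zero]
      exact (div_pos (hφ _) (hE u i)).le
    obtain ⟨-, h1, h2⟩ := h
    have hz : ∑ τ, (if τ (u, i) = true ∧ τ (u, j) = true then wt (ktrans μ k) φ τ else 0) = 0 := by
      refine Finset.sum_eq_zero fun τ _ => ?_
      split_ifs with hh
      · by_contra hne
        have : ktrans μ k τ ≠ 0 := fun h0 => hne (by simp [wt, h0])
        exact hij (ktrans_atmost μ k τ this u i j hh.1 hh.2)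
      · rfl
    unfold condPlusProb
    rw [sum_false_eq', sum_false_eq, hz, hone, hone, hZk, hsplit u]
    rw [sum_false_eq, hone, hZk, hsplit u] at h2
    have hN := hnn (fun σ => σ u = false) inferInstance
    have hA := hnn (fun σ => σ u = true) inferInstance
    have hSu := hS u
    have hEu := hE u i
    have hSEu := hSE u i
    generalize (∑ σ, if σ u = true then wt μ (av φ) σ else 0) = A at *
    generalize (∑ σ, if σ u = false then wt μ (av φ) σ else 0) = N at *
    generalize (∑ h ∈ Finset.univ.erase i, φ (u, h)) = E at *
    generalize (∑ h, φ (u, h)) = S at *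
    have hj := hφ (u, j)
    rw [zero_div, zero_sub, abs_neg, sub_zero]
    rw [abs_of_nonneg (div_nonneg (by positivity) h2.le), div_le_div_iff₀ h2 hEu]
    have e1 : φ (u, i) = S - E := by linarith
    have : φ (u, j) * (N + A - φ (u, i) / S * A) - φ (u, j) / S * A * E = φ (u, j) * N := by
      rw [e1]; field_simp; ring
    have := mul_nonneg hj.le hN
    linarith
end
end

section
/- Let μ be a distribution over {-1,+1}^V with n = |V|, let k ≥ 1 and 1 ≤ ℓ ≤ kn be integers, and f: {-1,+1}^V → ℝ_{≥0}. Define H_f(ℓ,k) = (1/binom(nk,ℓ)) Σ_{S ⊆ V×[k], |S| = ℓ} μ_k[Ent_S[f^k]]. Then H_f(ℓ,k) = Σ_{b: kb ∈ Ω(HG(V,k,ℓ))} HG(V,k,ℓ)(kb) Σ_{τ ∈ Ω(μ)} μ(τ) Σ_{R ⊆ τ⁻¹(+1): b_v > 0 for all v ∈ τ⁻¹(+1)∖R} ( Π_{u∈R}(1−b_u) · Π_{v∈τ⁻¹(+1)∖R} b_v ) · Ent_{μ^{(b_{V∖R}), 𝟙_R}}[f], where τ⁻¹(+1) = {v ∈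 V : τ_v = +1}. -/
open Classical Finset

noncomputable section

open PaperIsing
namespace UBFAux

def hEnt {A : Type*} [Fintype A] (w f : A → ℝ) : ℝ :=
  (∑ a, w a * (f a * Real.log (f a))) -
    (∑ a, w a * f a) * Real.log ((∑ a, w a * f a) / ∑ a, w a)

theorem hEnt_smul {A : Type*} [Fintype A] (c : ℝ) (w f : A → ℝ) :
    hEnt (fun a => c * w a) f = c * hEnt w f := by
  unfold hEnt
  simp only [mul_assoc, ← Finset.mul_sum]
  by_cases hc : c = 0
  · simp [hc]
  · rw [mul_div_mul_left _ _ hc]; ring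

theorem hEnt_zero {A : Type*} [Fintype A] (f : A → ℝ) :
    hEnt (fun _ => 0) f = 0 := by
  simp [hEnt]

theorem hEnt_push {A B : Type*} [Fintype A] [Fintype B] [DecidableEq B] (g : A → B)
    (w : A → ℝ) (f : B → ℝ) :
    hEnt w (fun a => f (g a)) = hEnt (fun b => ∑ a, if g a = b then w a else 0) f := by
  have key : ∀ F : B → ℝ, ∑ b, (∑ a, if g a = b then w a else 0) * F b
      = ∑ a, w a * F (g a) := by
    intro F
    simp only [Finset.sum_mul]
    rw [Finset.sum_comm]
    refine Finset.sum_congr rfl fun a _ => ?_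
    simp [ite_mul]
  have k1 := key (fun _ => 1)
  simp only [mul_one] at k1
  unfold hEnt
  rw [key, key, k1]

theorem hEnt_norm {A : Type*} [Fintype A] (w f : A → ℝ) (hw : ∀ a, 0 ≤ w a) :
    (∑ a, w a) * entOf (fun a => w a / ∑ a, w a) f = hEnt w f := by
  by_cases hZ : ∑ a, w a = 0
  · have h0 : ∀ a, w a = 0 := by
      intro a
      exact (Finset.sum_eq_zero_iff_of_nonneg (fun a _ => hw a)).1 hZ a (Finset.mem_univ a)
    simp [hEnt, h0]
  · unfold entOf hEnt
    have key : ∀ F : A → ℝ, ∑ a, w a / (∑ a, w a) * F a = (∑ a, w a * F a) / ∑ a, w a := by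
      intro F
      rw [Finset.sum_div]
      exact Finset.sum_congr rfl fun a _ => by ring
    rw [key, key]
    field_simp

theorem margin_ent {V : Type*} [Fintype V] [DecidableEq V] (ν : Conf V → ℝ)
    (hν : ∀ σ, 0 ≤ ν σ) (Λ : Finset V) (χ : Conf V) (f : Conf V → ℝ) :
    margin ν Λ χ * entOf (condDist ν Λ χ) f
      = hEnt (fun σ => if ∀ v ∈ Λ, σ v = χ v then ν σ else 0) f := by
  rw [← hEnt_norm]
  · unfold margin
    congr 2
    funext σ
    unfold condDist margin
    split_ifs <;> simp
  · intro σ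
    split_ifs
    · exact hν σ
    · exact le_rfl

/-- the unnormalised tilted pinned weight -/
def wR {V : Type*} [Fintype V] [DecidableEq V] (μ : Conf V → ℝ) (b : V → ℝ) (R : Finset V)
    (τ : Conf V) : ℝ :=
  if ∀ v ∈ R, τ v = true then μ τ * ∏ v, (if τ v then (if v ∈ R then 1 else b v) else 1) else 0

theorem wR_nonneg {V : Type*} [Fintype V] [DecidableEq V] (μ : Conf V → ℝ) (b : V → ℝ)
    (R : Finset V) (hμ : ∀ σ, 0 ≤ μ σ) (hb : ∀ v, 0 ≤ b v) (τ : Conf V) : 0 ≤ wR μ b R τ := by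
  unfold wR
  split_ifs
  · refine mul_nonneg (hμ _) (Finset.prod_nonneg fun v _ => ?_)
    split_ifs <;> first | exact hb v | exact zero_le_one
  · exact le_rfl

theorem wR_ent {V : Type*} [Fintype V] [DecidableEq V] (μ : Conf V → ℝ) (b : V → ℝ)
    (R : Finset V) (hμ : ∀ σ, 0 ≤ μ σ) (hb : ∀ v, 0 ≤ b v) (f : Conf V → ℝ) :
    (∑ τ, wR μ b R τ) * entOf (condDist (magnetize μ (fun v => if v ∈ R then 1 else b v))
      R (fun _ => true)) f = hEnt (wR μ b R) f := by
  have hw := wR_nonneg μ b R hμ hb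
  rw [← hEnt_norm _ _ hw]
  by_cases hZ : ∑ τ, wR μ b R τ = 0
  · simp [hZ]
  · congr 2
    funext σ
    set M := ∑ τ : Conf V, μ τ * ∏ v : V, (if τ v then (if v ∈ R then 1 else b v) else 1) with hM
    have hle : ∑ τ, wR μ b R τ ≤ M := by
      refine Finset.sum_le_sum fun τ _ => ?_
      unfold wR
      split_ifs
      · exact le_rfl
      · refine mul_nonneg (hμ _) (Finset.prod_nonneg fun v _ => ?_)
        split_ifs <;> first | exact hb v | exact zero_le_one
    have hpos : 0 < ∑ τ, wR μ b R τ :=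
      lt_of_le_of_ne (Finset.sum_nonneg fun τ _ => hw τ) (Ne.symm hZ)
    have hM0 : M ≠ 0 := (lt_of_lt_of_le hpos hle).ne'
    have hmar : margin (magnetize μ (fun v => if v ∈ R then 1 else b v)) R (fun _ => true)
        = (∑ τ, wR μ b R τ) / M := by
      unfold margin
      rw [Finset.sum_div]
      refine Finset.sum_congr rfl fun τ _ => ?_
      unfold wR magnetize
      split_ifs
      · rfl
      · simp
    unfold condDist
    rw [hmar]
    unfold magnetize
    rw [← hM]
    conv_rhs => unfold wR
    split_ifs
    · rw [div_div_div_cancel_right₀ hM0]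
      rfl
    · simp

def Q {k : ℕ} (T : Finset (Fin k)) (y : Fin k → Bool) (t : Prop) (x : Fin k → Bool) : Prop :=
  (Finset.univ.filter (fun i => x i = true)).card ≤ 1 ∧ ((∃ i, x i = true) ↔ t) ∧
        ∀ i, i ∉ T → x i = y i

def Q2 {k : ℕ} (T : Finset (Fin k)) (t : Prop) (x : Fin k → Bool) : Prop :=
  (Finset.univ.filter (fun i => x i = true)).card ≤ 1 ∧ ((∃ i, x i = true) ↔ t) ∧
        ∀ i ∈ T, x i = false

/-- number of single-plus fibre configurations that vanish on `T` -/
theorem fiber_count {k : ℕ} (T : Finset (Fin k)) (t : Prop) (ht : t) :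
    (Finset.univ.filter (fun x : Fin k → Bool => Q2 T t x)).card = (Finset.univ \ T).card := by
  symm
  refine Finset.card_bij (fun i _ => fun j => decide (j = i)) ?_ ?_ ?_
  · intro i hi
    simp only [Finset.mem_sdiff, Finset.mem_univ, true_and] at hi
    simp only [Finset.mem_filter, Finset.mem_univ, true_and, decide_eq_true_eq,
      decide_eq_false_iff_not, Q2, ht, iff_true]
    refine ⟨?_, ⟨i, rfl⟩, ?_⟩
    · simp [Finset.filter_eq']
    · rintro j hj rfl
      exact hi hj
  · intro i _ j _ h
    have := congrFun h i
    simpa using this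
  · intro x hx
    simp only [Finset.mem_filter, Finset.mem_univ, true_and, Q2, ht, iff_true] at hx
    obtain ⟨h1, ⟨i, hi⟩, h3⟩ := hx
    refine ⟨i, ?_, ?_⟩
    · simp only [Finset.mem_sdiff, Finset.mem_univ, true_and]
      intro hT
      simp [h3 i hT] at hi
    · funext j
      rw [Finset.card_le_one] at h1
      by_cases hj : x j = true
      · have := h1 j (by simp [hj]) i (by simp [hi])
        simp [this, hi]
      · have : j ≠ i := by rintro rfl; exact hj hi
        simp [this, hj]

theorem sum_pi {V X : Type*} [Fintype V] [DecidableEq V] [Fintype X]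
    (P : V → X → Prop) (c : V → ℝ) :
    (∑ x : V → X, if ∀ v, P v (x v) then ∏ v, c v else 0)
      = ∏ v, ((Finset.univ.filter (fun x : X => P v x)).card * c v) := by
  have h1 : ∀ v, ((Finset.univ.filter (fun x : X => P v x)).card * c v : ℝ)
      = ∑ x : X, if P v x then c v else 0 := by
    intro v
    rw [← Finset.sum_filter, Finset.sum_const, nsmul_eq_mul]
  simp only [h1]
  rw [Finset.prod_univ_sum, Fintype.piFinset_univ]
  refine Finset.sum_congr rfl fun x _ => ?_
  split_ifs with h
  · exact Finset.prod_congr rfl fun v _ => by rw [if_pos (h v)]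
  · push Not at h
    obtain ⟨v, hv⟩ := h
    symm
    exact Finset.prod_eq_zero (Finset.mem_univ v) (by rw [if_neg hv])

theorem sum_conf {V : Type*} [Fintype V] [DecidableEq V] {k : ℕ}
    (P : V → (Fin k → Bool) → Prop) (c : V → ℝ) :
    (∑ σ : Conf (V × Fin k), if ∀ v, P v (fun i => σ (v, i)) then ∏ v, c v else 0)
      = ∏ v, ((Finset.univ.filter (fun x : Fin k → Bool => P v x)).card * c v) := by
  rw [← sum_pi]
  exact Fintype.sum_equiv (Equiv.curry V (Fin k) Bool) _ _ (fun σ => rfl)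

def fib {V : Type*} [Fintype V] [DecidableEq V] {k : ℕ} (S : Finset (V × Fin k)) (v : V) :
    Finset (Fin k) := Finset.univ.filter (fun i => (v, i) ∈ S)

theorem plusSet_kstar {V : Type*} [Fintype V] [DecidableEq V] {k : ℕ} (χ : Conf (V × Fin k))
    (v : V) : v ∈ plusSet (kstar χ) ↔ ∃ i, χ (v, i) = true := by
  simp [plusSet, kstar]

theorem kpow {V : Type*} [Fintype V] [DecidableEq V] (c : ℝ) (τ : Conf V) :
    c ^ plusCount τ = ∏ v, if τ v = true then c else 1 := by
  rw [Finset.prod_ite]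
  simp [plusCount, plusSet]

def Good {V : Type*} [Fintype V] [DecidableEq V] {k : ℕ} (χ : Conf (V × Fin k)) : Prop :=
  ∀ v : V, (Finset.univ.filter (fun i : Fin k => χ (v, i) = true)).card ≤ 1

theorem push_eq {V : Type*} [Fintype V] [DecidableEq V] (μ : Conf V → ℝ) (k : ℕ)
    (S : Finset (V × Fin k)) (χ : Conf (V × Fin k)) (τ : Conf V) :
    (∑ σ : Conf (V × Fin k), if kstar σ = τ then
      (if ∀ w ∈ Finset.univ \ S, σ w = χ w then ktrans μ k σ else 0) else 0)
    = μ τ * ∏ v, (((Finset.univ.filter (fun x : Fin k → Bool =>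
        Q (fib S v) (fun i => χ (v, i)) (τ v = true) x)).card : ℝ) * (if τ v = true then (k : ℝ)⁻¹ else 1)) := by
  rw [← sum_conf (fun v => Q (fib S v) (fun i => χ (v, i)) (τ v = true)), Finset.mul_sum]
  refine Finset.sum_congr rfl fun σ _ => ?_
  have e1 : kstar σ = τ ↔ ∀ v, ((∃ i, σ (v, i) = true) ↔ τ v = true) := by
    rw [funext_iff]
    refine forall_congr' fun v => ?_
    unfold kstar
    rw [Bool.eq_iff_iff, decide_eq_true_eq]
  have e2 : (∀ w ∈ Finset.univ \ S, σ w = χ w) ↔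
      ∀ v, ∀ i, i ∉ fib S v → σ (v, i) = χ (v, i) := by
    simp [fib]
  by_cases h1 : kstar σ = τ
  · rw [if_pos h1]
    by_cases h2 : ∀ w ∈ Finset.univ \ S, σ w = χ w
    · rw [if_pos h2]
      unfold ktrans
      by_cases h3 : ∀ v : V, (Finset.univ.filter (fun i : Fin k => σ (v, i) = true)).card ≤ 1
      · rw [if_pos h3, if_pos (fun v => ⟨h3 v, e1.1 h1 v, e2.1 h2 v⟩), h1, kpow]
      · rw [if_neg h3, if_neg (fun h => h3 fun v => (h v).1), mul_zero]
    · rw [if_neg h2, if_neg (fun h => h2 (e2.2 fun v => (h v).2.2)), mul_zero]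
  · rw [if_neg h1, if_neg (fun h => h1 (e1.2 fun v => (h v).2.1)), mul_zero]

theorem fib_bad {k : ℕ} (T : Finset (Fin k)) (y : Fin k → Bool) (hy : ∀ i ∈ T, y i = false)
    (h : ¬ (Finset.univ.filter (fun i => y i = true)).card ≤ 1) (t : Prop) :
    (Finset.univ.filter (fun x : Fin k → Bool => Q T y t x)) = ∅ := by
  rw [Finset.filter_eq_empty_iff]
  rintro x - ⟨h1, -, h3⟩
  apply h
  refine le_trans (Finset.card_le_card ?_) h1
  intro i hi
  simp only [Finset.mem_filter, Finset.mem_univ, true_and] at hi ⊢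
  rw [h3 i ?_, hi]
  intro hT
  simp [hy i hT] at hi

theorem fib_one {k : ℕ} (T : Finset (Fin k)) (y : Fin k → Bool) (hy : ∀ i ∈ T, y i = false)
    (h : (Finset.univ.filter (fun i => y i = true)).card ≤ 1) (he : ∃ i, y i = true) (t : Prop) :
    (Finset.univ.filter (fun x : Fin k → Bool => Q T y t x)).card = if t then 1 else 0 := by
  obtain ⟨i, hi⟩ := he
  have hiT : i ∉ T := fun hT => by simp [hy i hT] at hi
  split_ifs with ht
  · rw [Finset.card_eq_one]
    refine ⟨y, ?_⟩
    ext x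
    simp only [Finset.mem_filter, Finset.mem_univ, true_and, Finset.mem_singleton]
    constructor
    · rintro ⟨h1, -, h3⟩
      have hxi : x i = true := by rw [h3 i hiT, hi]
      funext j
      by_cases hj : j ∈ T
      · rw [hy j hj]
        by_contra hx
        rw [Bool.not_eq_false] at hx
        rw [Finset.card_le_one] at h1
        have := h1 j (by simp [hx]) i (by simp [hxi])
        exact hiT (this ▸ hj)
      · exact h3 j hj
    · rintro rfl
      exact ⟨h, by simp only [ht, iff_true]; exact ⟨i, hi⟩, fun _ _ => rfl⟩
  · rw [Finset.card_eq_zero, Finset.filter_eq_empty_iff]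
    rintro x - ⟨-, h2, h3⟩
    exact ht (h2.1 ⟨i, by rw [h3 i hiT, hi]⟩)

theorem fib_none {k : ℕ} (T : Finset (Fin k)) (y : Fin k → Bool)
    (he : ¬ ∃ i, y i = true) (t : Prop) :
    (Finset.univ.filter (fun x : Fin k → Bool => Q T y t x)).card = if t then T.card else 1 := by
  have hy : ∀ i, y i = false := fun i => by
    by_contra h
    exact he ⟨i, by simpa using h⟩
  split_ifs with ht
  · have := fiber_count (Finset.univ \ T) t ht
    rw [Finset.sdiff_sdiff_eq_self (Finset.subset_univ _)] at this
    rw [← this]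
    congr 1
    ext x
    simp [ht, hy, Q, Q2]
  · rw [Finset.card_eq_one]
    refine ⟨fun _ => false, ?_⟩
    ext x
    simp only [Finset.mem_filter, Finset.mem_univ, true_and, Finset.mem_singleton, ht, iff_false, Q]
    constructor
    · rintro ⟨-, h2, -⟩
      funext j
      by_contra h
      exact h2 ⟨j, by simpa using h⟩
    · rintro rfl
      simp [hy]

theorem push_good {V : Type*} [Fintype V] [DecidableEq V] (μ : Conf V → ℝ) (k : ℕ)
    (S : Finset (V × Fin k)) (χ : Conf (V × Fin k)) (hχ : ∀ w ∈ S, χ w = false)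
    (hg : Good χ) (τ : Conf V) :
    (∑ σ : Conf (V × Fin k), if kstar σ = τ then
      (if ∀ w ∈ Finset.univ \ S, σ w = χ w then ktrans μ k σ else 0) else 0)
    = (k : ℝ)⁻¹ ^ (plusSet (kstar χ)).card *
      wR μ (fun v => ((fib S v).card : ℝ) / k) (plusSet (kstar χ)) τ := by
  rw [push_eq]
  have hy : ∀ v, ∀ i ∈ fib S v, χ (v, i) = false := fun v i hi =>
    hχ _ (by simpa [fib] using hi)
  have hfac : ∀ v, (((Finset.univ.filter (fun x : Fin k → Bool =>
        Q (fib S v) (fun i => χ (v, i)) (τ v = true) x)).card : ℝ) * (if τ v = true then (k : ℝ)⁻¹ else 1))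
      = (if v ∈ plusSet (kstar χ) then (k : ℝ)⁻¹ else 1) *
        if v ∈ plusSet (kstar χ) ∧ τ v ≠ true then 0 else
        (if τ v then (if v ∈ plusSet (kstar χ) then 1 else ((fib S v).card : ℝ) / k) else 1) := by
    intro v
    by_cases he : v ∈ plusSet (kstar χ)
    · rw [fib_one _ (fun i => χ (v, i)) (hy v) (hg v) ((plusSet_kstar χ v).1 he)]
      by_cases ht : τ v = true <;> simp [he, ht]
    · rw [fib_none _ (fun i => χ (v, i)) (fun h => he ((plusSet_kstar χ v).2 h))]
      by_cases ht : τ v = true <;> simp [he, ht, div_eq_mul_inv]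
  rw [Finset.prod_congr rfl (fun v _ => hfac v), Finset.prod_mul_distrib]
  have hp : ∏ v, (if v ∈ plusSet (kstar χ) then (k : ℝ)⁻¹ else 1)
      = (k : ℝ)⁻¹ ^ (plusSet (kstar χ)).card := by
    rw [Finset.prod_ite_mem, Finset.univ_inter, Finset.prod_const]
  rw [hp]
  unfold wR
  split_ifs with h
  · rw [mul_left_comm]
    congr 2
    refine Finset.prod_congr rfl fun v _ => ?_
    rw [if_neg]
    rintro ⟨h1, h2⟩
    exact h2 (h v h1)
  · push Not at h
    obtain ⟨v, hv, hv'⟩ := h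
    rw [Finset.prod_eq_zero (Finset.mem_univ v) (by rw [if_pos ⟨hv, hv'⟩])]
    simp

theorem push_bad {V : Type*} [Fintype V] [DecidableEq V] (μ : Conf V → ℝ) (k : ℕ)
    (S : Finset (V × Fin k)) (χ : Conf (V × Fin k)) (hχ : ∀ w ∈ S, χ w = false)
    (hg : ¬ Good χ) (τ : Conf V) :
    (∑ σ : Conf (V × Fin k), if kstar σ = τ then
      (if ∀ w ∈ Finset.univ \ S, σ w = χ w then ktrans μ k σ else 0) else 0) = 0 := by
  rw [push_eq]
  have hy : ∀ v, ∀ i ∈ fib S v, χ (v, i) = false := fun v i hi =>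
    hχ _ (by simpa [fib] using hi)
  unfold Good at hg
  rw [not_forall] at hg
  obtain ⟨v, hv⟩ := hg
  rw [Finset.prod_eq_zero (Finset.mem_univ v), mul_zero]
  rw [fib_bad _ (fun i => χ (v, i)) (hy v) hv]
  simp

theorem ktrans_nonneg {V : Type*} [Fintype V] [DecidableEq V] (μ : Conf V → ℝ)
    (hμ : ∀ σ, 0 ≤ μ σ) (k : ℕ) (σ : Conf (V × Fin k)) : 0 ≤ ktrans μ k σ := by
  unfold ktrans
  split_ifs
  · exact mul_nonneg (hμ _) (by positivity)
  · exact le_rfl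

theorem count_chi {V : Type*} [Fintype V] [DecidableEq V] (k : ℕ) (hk : 1 ≤ k)
    (S : Finset (V × Fin k)) (R : Finset V) :
    (∑ χ : Conf (V × Fin k), if ((∀ w ∈ S, χ w = false) ∧ Good χ) ∧ plusSet (kstar χ) = R then
      (k : ℝ)⁻¹ ^ R.card else 0) = ∏ u ∈ R, (1 - ((fib S u).card : ℝ) / k) := by
  have hk0 : (k : ℝ) ≠ 0 := by positivity
  have hp : (k : ℝ)⁻¹ ^ R.card = ∏ v, (if v ∈ R then (k : ℝ)⁻¹ else 1) := by
    rw [Finset.prod_ite_mem, Finset.univ_inter, Finset.prod_const]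
  have h0 : ∀ χ : Conf (V × Fin k),
      (((∀ w ∈ S, χ w = false) ∧ Good χ) ∧ plusSet (kstar χ) = R) ↔
      ∀ v, Q2 (fib S v) (v ∈ R) (fun i => χ (v, i)) := by
    intro χ
    constructor
    · rintro ⟨⟨h1, h2⟩, rfl⟩ v
      exact ⟨h2 v, (plusSet_kstar χ v).symm, fun i hi => h1 _ (by simpa [fib] using hi)⟩
    · intro h
      refine ⟨⟨?_, fun v => (h v).1⟩, ?_⟩
      · rintro ⟨v, i⟩ hw
        exact (h v).2.2 i (by simpa [fib] using hw)
      · ext v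
        rw [plusSet_kstar, (h v).2.1]
  refine (Finset.sum_congr rfl fun χ _ => if_congr (h0 χ) hp rfl).trans
    ((sum_conf (fun v => Q2 (fib S v) (v ∈ R)) (fun v => if v ∈ R then (k : ℝ)⁻¹ else 1)).trans ?_)
  rw [← Finset.univ_inter R, ← Finset.prod_ite_mem]
  simp only [Finset.univ_inter]
  refine Finset.prod_congr rfl fun v _ => ?_
  by_cases hv : v ∈ R
  · rw [if_pos hv, if_pos hv, fiber_count _ _ hv, Finset.card_sdiff_of_subset (Finset.subset_univ _),
      Nat.cast_sub (Finset.card_le_card (Finset.subset_univ _))]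
    simp
    field_simp
  · rw [if_neg hv, if_neg hv, mul_one, Nat.cast_eq_one, Finset.card_eq_one]
    refine ⟨fun _ => false, ?_⟩
    ext x
    simp only [Finset.mem_filter, Finset.mem_univ, true_and, Finset.mem_singleton, Q2, hv,
      iff_false]
    constructor
    · rintro ⟨-, h2, -⟩
      funext j
      by_contra h
      exact h2 ⟨j, by simpa using h⟩
    · rintro rfl
      simp

theorem avgEnt_eq {V : Type*} [Fintype V] [DecidableEq V] (μ : Conf V → ℝ)
    (hμ : ∀ σ, 0 ≤ μ σ) (k : ℕ) (hk : 1 ≤ k) (S : Finset (V × Fin k)) (f : Conf V → ℝ) :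
    avgEnt (ktrans μ k) S (fun σ => f (kstar σ))
      = ∑ R : Finset V, (∏ u ∈ R, (1 - ((fib S u).card : ℝ) / k)) *
          hEnt (wR μ (fun v => ((fib S v).card : ℝ) / k) R) f := by
  have step : ∀ χ : Conf (V × Fin k),
      (if ∀ v ∈ S, χ v = false then margin (ktrans μ k) (Finset.univ \ S) χ *
        entOf (condDist (ktrans μ k) (Finset.univ \ S) χ) (fun σ => f (kstar σ)) else 0)
      = ∑ R : Finset V,
        (if ((∀ w ∈ S, χ w = false) ∧ Good χ) ∧ plusSet (kstar χ) = R then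
          (k : ℝ)⁻¹ ^ R.card else 0) * hEnt (wR μ (fun v => ((fib S v).card : ℝ) / k) R) f := by
    intro χ
    by_cases h1 : ∀ w ∈ S, χ w = false
    · rw [if_pos h1, margin_ent _ (ktrans_nonneg μ hμ k), hEnt_push]
      by_cases h2 : Good χ
      · rw [funext (push_good μ k S χ h1 h2), hEnt_smul]
        rw [Finset.sum_eq_single (plusSet (kstar χ))]
        · rw [if_pos ⟨⟨h1, h2⟩, rfl⟩]
        · intro R _ hR
          rw [if_neg (fun h => hR h.2.symm), zero_mul]
        · simp
      · rw [funext (push_bad μ k S χ h1 h2), hEnt_zero]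
        symm
        exact Finset.sum_eq_zero fun R _ => by rw [if_neg (fun h => h2 h.1.2), zero_mul]
    · rw [if_neg h1]
      symm
      exact Finset.sum_eq_zero fun R _ => by rw [if_neg (fun h => h1 h.1.1), zero_mul]
  unfold avgEnt
  rw [Finset.sum_congr rfl (fun χ _ => step χ), Finset.sum_comm]
  refine Finset.sum_congr rfl fun R _ => ?_
  rw [← Finset.sum_mul, count_chi k hk]

theorem rhs_eq {V : Type*} [Fintype V] [DecidableEq V] (μ : Conf V → ℝ)
    (hμ : ∀ σ, 0 ≤ μ σ) (k : ℕ) (a : V → ℕ) (f : Conf V → ℝ) :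
    (∑ τ : Conf V, μ τ *
            ∑ R : Finset V,
              (if R ⊆ plusSet τ ∧ (∀ v ∈ plusSet τ \ R, 0 < a v)
               then (∏ u ∈ R, (1 - (a u : ℝ) / (k : ℝ))) *
                    (∏ v ∈ plusSet τ \ R, (a v : ℝ) / (k : ℝ)) *
                    entOf (condDist
                      (magnetize μ (fun v => if v ∈ R then 1 else (a v : ℝ) / (k : ℝ)))
                      R (fun _ => true)) f
               else 0))
    = ∑ R : Finset V, (∏ u ∈ R, (1 - (a u : ℝ) / k)) *
          hEnt (wR μ (fun v => (a v : ℝ) / k) R) f := by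
  simp only [Finset.mul_sum]
  rw [Finset.sum_comm]
  refine Finset.sum_congr rfl fun R _ => ?_
  rw [← wR_ent _ _ _ hμ (fun v => by positivity), ← mul_assoc, Finset.mul_sum, Finset.sum_mul]
  refine Finset.sum_congr rfl fun τ _ => ?_
  have hsub : R ⊆ plusSet τ ↔ ∀ v ∈ R, τ v = true := by
    simp [Finset.subset_iff, plusSet]
  have hprod : ∏ v, (if τ v then (if v ∈ R then 1 else (a v : ℝ) / k) else 1)
      = ∏ v ∈ plusSet τ \ R, (a v : ℝ) / k := by
    rw [← Finset.univ_inter (plusSet τ \ R), ← Finset.prod_ite_mem]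
    refine Finset.prod_congr rfl fun v _ => ?_
    by_cases h1 : τ v = true <;> by_cases h2 : v ∈ R <;> simp [plusSet, h1, h2]
  unfold wR
  rw [hprod]
  by_cases h1 : R ⊆ plusSet τ
  · rw [if_pos (hsub.1 h1)]
    by_cases h2 : ∀ v ∈ plusSet τ \ R, 0 < a v
    · rw [if_pos ⟨h1, h2⟩]; ring
    · rw [if_neg (fun h => h2 h.2)]
      push Not at h2
      obtain ⟨v, hv, hv'⟩ := h2
      rw [Finset.prod_eq_zero hv (by simp [Nat.le_zero.1 hv'])]
      ring
  · rw [if_neg (fun h => h1 h.1), if_neg (fun h => h1 (hsub.2 h))]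
    ring

theorem card_fib {V : Type*} [Fintype V] [DecidableEq V] {k : ℕ} (S : Finset (V × Fin k)) :
    ∑ v, (fib S v).card = S.card := by
  rw [Finset.card_eq_sum_card_fiberwise (f := Prod.fst) (t := Finset.univ) (by simp)]
  refine Finset.sum_congr rfl fun v _ => ?_
  refine Finset.card_bij (fun i _ => (v, i)) ?_ ?_ ?_
  · intro i hi
    simpa [fib] using hi
  · intro i _ j _ h
    simpa using h
  · rintro ⟨u, i⟩ h
    simp only [Finset.mem_filter] at h
    obtain ⟨h1, rfl⟩ := h
    exact ⟨i, by simpa [fib] using h1, rfl⟩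

theorem count_S {V : Type*} [Fintype V] [DecidableEq V] {k : ℕ} (a : V → ℕ) :
    (Finset.univ.filter (fun S : Finset (V × Fin k) => ∀ v, (fib S v).card = a v)).card
      = ∏ v, Nat.choose k (a v) := by
  have : ∏ v, Nat.choose k (a v) = (Fintype.piFinset
      (fun v => Finset.powersetCard (a v) (Finset.univ : Finset (Fin k)))).card := by
    rw [Fintype.card_piFinset]
    simp
  rw [this]
  refine Finset.card_bij (fun S _ => fib S) ?_ ?_ ?_
  · intro S hS
    simpa [Fintype.mem_piFinset, Finset.mem_powersetCard] using hS
  · intro S _ S' _ h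
    ext ⟨v, i⟩
    have := congrFun h v
    have := Finset.ext_iff.1 this i
    simpa [fib] using this
  · intro g hg
    have hfg : fib (Finset.univ.filter (fun w : V × Fin k => w.2 ∈ g w.1)) = g := by
      funext v
      ext i
      simp [fib]
    refine ⟨Finset.univ.filter (fun w => w.2 ∈ g w.1), ?_, hfg⟩
    simpa [Fintype.mem_piFinset, Finset.mem_powersetCard, hfg] using hg

theorem sum_S {V : Type*} [Fintype V] [DecidableEq V] (k ℓ : ℕ) (G : (V → ℕ) → ℝ) :
    (Nat.choose (Fintype.card V * k) ℓ : ℝ)⁻¹ *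
        ∑ S ∈ Finset.powersetCard ℓ (Finset.univ : Finset (V × Fin k)),
          G (fun v => (fib S v).card)
      = ∑ a : V → Fin (k + 1), hyperGeo V k ℓ (fun w => (a w).val) * G (fun w => (a w).val) := by
  have h1 : ∀ S : Finset (V × Fin k), G (fun v => (fib S v).card) =
      ∑ a : V → Fin (k + 1), if ∀ v, (fib S v).card = (a v).val then G (fun w => (a w).val)
        else 0 := by
    intro S
    have hlt : ∀ v, (fib S v).card < k + 1 := fun v => by
      have := Finset.card_le_univ (fib S v)
      simp at this
      omega
    rw [Finset.sum_eq_single (fun v => ⟨(fib S v).card, hlt v⟩)]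
    · simp
    · intro a _ ha
      rw [if_neg]
      intro h
      apply ha
      funext v
      ext
      exact (h v).symm
    · simp
  rw [Finset.sum_congr rfl (fun S _ => h1 S), Finset.sum_comm, Finset.mul_sum]
  refine Finset.sum_congr rfl fun a _ => ?_
  rw [← Finset.sum_filter, Finset.sum_const, nsmul_eq_mul]
  unfold hyperGeo
  by_cases hs : ∑ v, (a v).val = ℓ
  · rw [if_pos hs, mul_comm k]
    have : Finset.filter (fun S : Finset (V × Fin k) => ∀ v, (fib S v).card = (a v).val)
        (Finset.powersetCard ℓ Finset.univ)
        = Finset.univ.filter (fun S => ∀ v, (fib S v).card = (a v).val) := by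
      ext S
      simp only [Finset.mem_filter, Finset.mem_powersetCard, Finset.mem_univ, true_and,
        Finset.subset_univ, and_iff_right_iff_imp]
      intro h
      rw [← card_fib, Finset.sum_congr rfl (fun v _ => h v), hs]
    rw [this, count_S]
    push_cast
    ring
  · rw [if_neg hs, Finset.filter_false_of_mem]
    · simp
    · intro S hS h
      rw [Finset.mem_powersetCard] at hS
      apply hs
      rw [← hS.2, ← card_fib]
      exact Finset.sum_congr rfl (fun v _ => (h v).symm)

end UBFAux

/-- Exact expression for
`H_f(ℓ,k) = (1/C(nk,ℓ)) Σ_{S ⊆ V×[k], |S|=ℓ} μ_k[Ent_S[f^k]]` in terms of the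
multivariate hypergeometric distribution and magnetized conditioned distributions. -/
theorem ubf_average_formula {V : Type*} [Fintype V] [DecidableEq V]
    (μ : Conf V → ℝ) (hμ : IsDist μ) (k ℓ : ℕ) (hk : 1 ≤ k)
    (hℓ1 : 1 ≤ ℓ) (hℓ2 : ℓ ≤ k * Fintype.card V)
    (f : Conf V → ℝ) (hf : ∀ σ, 0 ≤ f σ) :
    (Nat.choose (Fintype.card V * k) ℓ : ℝ)⁻¹ *
        ∑ S ∈ Finset.powersetCard ℓ (Finset.univ : Finset (V × Fin k)),
          avgEnt (ktrans μ k) S (fun σ => f (kstar σ))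
      = ∑ a : V → Fin (k + 1), hyperGeo V k ℓ (fun w => (a w).val) *
          ∑ τ : Conf V, μ τ *
            ∑ R : Finset V,
              (if R ⊆ plusSet τ ∧ (∀ v ∈ plusSet τ \ R, 0 < (a v).val)
               then (∏ u ∈ R, (1 - ((a u).val : ℝ) / (k : ℝ))) *
                    (∏ v ∈ plusSet τ \ R, ((a v).val : ℝ) / (k : ℝ)) *
                    entOf (condDist
                      (magnetize μ (fun v => if v ∈ R then 1 else ((a v).val : ℝ) / (k : ℝ)))
                      R (fun _ => true)) f
               else 0) := by
  simp only [UBFAux.avgEnt_eq μ hμ.1 k hk]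
  rw [UBFAux.sum_S k ℓ (fun a => ∑ R : Finset V, (∏ u ∈ R, (1 - (a u : ℝ) / k)) *
          UBFAux.hEnt (UBFAux.wR μ (fun v => (a v : ℝ) / k) R) f)]
  refine Finset.sum_congr rfl fun a _ => ?_
  rw [← UBFAux.rhs_eq μ hμ.1 k (fun w => (a w).val) f]
end
end
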